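/- Fix an integer ℓ ≥ 0. Let V₁, V₂ : (0,∞) → ℝ be two potentials each satisfying the integrability conditions ∫₀^a r |Vᵢ(r)| dr < ∞ for every finite a > 0 and ∫_b^∞ |Vᵢ(r)| dr < ∞ for every b > 0, and each constant on some interval (0, ε) with ε > 0 (locally constant in the vicinity of zero). Let ψ₁ and ψ₂ be the regular solutions of the radial Schrödinger equation with potentials V₁ and V₂ respectively and angular momentum ℓ. Suppose there exist integers n₁, n₂ ≥ 1, an interval I ⊆ ℝ, and a continuous strictly decreasing function r̄ : I → (0,∞) surjective onto (0,∞), such that for every E ∈ I the point r̄(E) is simultaneously the n₁-th zero of ψ₁(E,·) and the n₂-th zero of ψ₂(E,·). Then V₁ = V₂ almost everywhere on (0,∞). -/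

import Mathlib

open Set Filter Topology MeasureTheory

/-- `ψ` is a regular solution of the radial Schrödinger equation
`ψ'' + (E − V(r) − ℓ(ℓ+1)/r²) ψ = 0` on `(0,∞)` with boundary condition
`ψ(r)/r^(ℓ+1) → 1` as `r → 0⁺`. -/
def IsRegularSolution (V : ℝ → ℝ) (ℓ E : ℝ) (ψ : ℝ → ℝ) : Prop :=
  (∀ r ∈ Set.Ioi (0 : ℝ), DifferentiableAt ℝ ψ r ∧ DifferentiableAt ℝ (deriv ψ) r) ∧
  (∀ r ∈ Set.Ioi (0 : ℝ),
    deriv (deriv ψ) r + (E - V r - ℓ * (ℓ + 1) / r ^ 2) * ψ r = 0) ∧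
  Tendsto (fun r => ψ r / r ^ (ℓ + 1)) (nhdsWithin 0 (Set.Ioi 0)) (nhds 1)

/-- `z` is the `n`-th zero of `f` on `(0,∞)`: `z > 0`, `f z = 0` and there are
exactly `n - 1` zeros of `f` in `(0, z)`. -/
def IsNthZero (f : ℝ → ℝ) (n : ℕ) (z : ℝ) : Prop :=
  0 < z ∧ f z = 0 ∧ {x ∈ Set.Ioo 0 z | f x = 0}.ncard = n - 1


/-! ### An integral Gronwall inequality with an integrable kernel -/

theorem aux_gronwall (k : ℝ → ℝ) (b : ℝ) (hb : 0 < b) (hk : IntervalIntegrable k volume 0 b)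
    (hk0 : ∀ s, 0 < s → 0 ≤ k s) :
    ∃ C : ℝ, 0 ≤ C ∧ ∀ (w : ℝ → ℝ) (A B : ℝ), 0 ≤ A →
      AEStronglyMeasurable w (volume.restrict (Ioc 0 b)) →
      (∀ r ∈ Ioc 0 b, 0 ≤ w r) → (∀ r ∈ Ioc 0 b, w r ≤ B) →
      (∀ r ∈ Ioc 0 b, w r ≤ A + ∫ s in (0:ℝ)..r, k s * w s) →
      ∀ r ∈ Ioc 0 b, w r ≤ C * A := by
  set K : ℝ → ℝ := fun r => ∫ s in (0:ℝ)..r, k s with hK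
  have hsub : ∀ x y, 0 ≤ x → x ≤ y → y ≤ b → IntervalIntegrable k volume x y := by
    intro x y hx hxy hy
    apply hk.mono_set
    rw [uIcc_of_le hxy, uIcc_of_le hb.le]
    exact Icc_subset_Icc hx hy
  have hKadd : ∀ x y, 0 ≤ x → x ≤ y → y ≤ b → K x + ∫ s in x..y, k s = K y := by
    intro x y hx hxy hy
    exact intervalIntegral.integral_add_adjacent_intervals (hsub 0 x le_rfl hx (hxy.trans hy))
      (hsub x y hx hxy hy)
  have hpos : ∀ x y, 0 ≤ x → x ≤ y → 0 ≤ ∫ s in x..y, k s := by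
    intro x y hx hxy
    rw [intervalIntegral.integral_of_le hxy]
    apply setIntegral_nonneg measurableSet_Ioc
    intro s hs
    exact hk0 s (lt_of_le_of_lt hx hs.1)
  have hKmono : ∀ x y, 0 ≤ x → x ≤ y → y ≤ b → K x ≤ K y := by
    intro x y hx hxy hy
    have := hKadd x y hx hxy hy
    have := hpos x y hx hxy
    linarith
  have hK0 : K 0 = 0 := by simp [hK]
  have hKcont : ContinuousOn K (Icc 0 b) := by
    have := intervalIntegral.continuousOn_primitive_interval' (a := 0) hk left_mem_uIcc
    rwa [uIcc_of_le hb.le] at this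
  -- integral bound
  have h_int : ∀ (w : ℝ → ℝ) (B μ x y : ℝ), AEStronglyMeasurable w (volume.restrict (Ioc 0 b)) →
      (∀ r ∈ Ioc 0 b, 0 ≤ w r) → (∀ r ∈ Ioc 0 b, w r ≤ B) → 0 ≤ x → x ≤ y → y ≤ b →
      IntervalIntegrable (fun s => k s * w s) volume x y ∧
      ((∀ s ∈ Ioc x y, w s ≤ μ) → ∫ s in x..y, k s * w s ≤ μ * ∫ s in x..y, k s) := by
    intro w B μ x y hw hw0 hwB hx hxy hy
    have h1 : IntervalIntegrable (fun s => k s * w s) volume x y := by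
      rw [intervalIntegrable_iff_integrableOn_Ioc_of_le hxy]
      have h2 := (intervalIntegrable_iff_integrableOn_Ioc_of_le hxy).1 (hsub x y hx hxy hy)
      have hss : Ioc x y ⊆ Ioc 0 b := Ioc_subset_Ioc hx hy
      refine Integrable.mul_bdd (c := B) h2 (hw.mono_measure (Measure.restrict_mono hss le_rfl)) ?_
      rw [ae_restrict_iff' measurableSet_Ioc]
      refine ae_of_all _ fun s hs => ?_
      rw [Real.norm_of_nonneg (hw0 s (hss hs))]
      exact hwB s (hss hs)
    refine ⟨h1, fun hμ => ?_⟩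
    rw [← intervalIntegral.integral_const_mul]
    rw [intervalIntegral.integral_of_le hxy, intervalIntegral.integral_of_le hxy]
    have h3 := (hsub x y hx hxy hy).const_mul μ
    rw [intervalIntegrable_iff_integrableOn_Ioc_of_le hxy] at h1 h3
    refine setIntegral_mono_on h1 h3 measurableSet_Ioc ?_
    intro s hs
    have := hk0 s (lt_of_le_of_lt hx hs.1)
    have := hμ s hs
    nlinarith
  have main : ∀ n : ℕ, ∃ C : ℝ, 0 ≤ C ∧ ∀ (w : ℝ → ℝ) (A B : ℝ), 0 ≤ A →
      AEStronglyMeasurable w (volume.restrict (Ioc 0 b)) →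
      (∀ r ∈ Ioc 0 b, 0 ≤ w r) → (∀ r ∈ Ioc 0 b, w r ≤ B) →
      (∀ r ∈ Ioc 0 b, w r ≤ A + ∫ s in (0:ℝ)..r, k s * w s) →
      ∀ r ∈ Ioc 0 b, K r ≤ n / 2 → w r ≤ C * A := by
    intro n
    induction n with
    | zero =>
      refine ⟨1, zero_le_one, ?_⟩
      intro w A B hA hw hw0 hwB hwi r hr hKr
      have h1 := (h_int w B B 0 r hw hw0 hwB le_rfl hr.1.le hr.2).2
        (fun s hs => hwB s ⟨hs.1, hs.2.trans hr.2⟩)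
      have h2 := hwi r hr
      have h3 : K r = 0 := by
        have := hKmono 0 r le_rfl hr.1.le hr.2
        simp at hKr
        linarith
      have h4 : (∫ s in (0:ℝ)..r, k s) = 0 := h3
      rw [h4] at h1
      linarith
    | succ n ih =>
      obtain ⟨C, hC, ih⟩ := ih
      have hKb : 0 ≤ K b := by have := hKmono 0 b le_rfl hb.le le_rfl; linarith
      refine ⟨2 * (1 + C * K b + C), by positivity, ?_⟩
      intro w A B hA hw hw0 hwB hwi r hr hKr
      have ih' := ih w A B hA hw hw0 hwB hwi
      have hD : C * A ≤ 2 * (1 + C * K b + C) * A := by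
        have : 0 ≤ C * K b * A := by positivity
        have : 0 ≤ C * A := by positivity
        nlinarith
      by_cases hle : K r ≤ n / 2
      · exact (ih' r hr hle).trans hD
      · push Not at hle
        obtain ⟨s0, hs0, hs0K⟩ : ∃ s0 ∈ Icc 0 r, K s0 = n / 2 := by
          have := intermediate_value_Icc hr.1.le (hKcont.mono (Icc_subset_Icc_right hr.2))
          obtain ⟨s0, h1, h2⟩ := this (show (n:ℝ)/2 ∈ Icc (K 0) (K r) by
            rw [hK0]; exact ⟨by positivity, hle.le⟩)
          exact ⟨s0, h1, h2⟩
        set μ := sSup (w '' Ioc 0 r) with hμ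
        have hbdd : BddAbove (w '' Ioc 0 r) := by
          refine ⟨B, ?_⟩
          rintro _ ⟨t, ht, rfl⟩
          exact hwB t ⟨ht.1, ht.2.trans hr.2⟩
        have hle_μ : ∀ t ∈ Ioc 0 r, w t ≤ μ := fun t ht => le_csSup hbdd ⟨t, ht, rfl⟩
        have hμ0 : 0 ≤ μ := (hw0 r hr).trans (hle_μ r ⟨hr.1, le_rfl⟩)
        have key : ∀ t ∈ Ioc 0 r, w t ≤ (1 + C * K b + C) * A + μ / 2 := by
          intro t ht
          have htb : t ∈ Ioc 0 b := ⟨ht.1, ht.2.trans hr.2⟩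
          have e1 : 0 ≤ C * K b * A := by positivity
          have e2 : 0 ≤ C * A := by positivity
          by_cases htn : K t ≤ n / 2
          · have := ih' t htb htn
            nlinarith
          · push Not at htn
            have hst : s0 ≤ t := by
              by_contra hcon
              push Not at hcon
              have := hKmono t s0 ht.1.le hcon.le (hs0.2.trans hr.2)
              linarith
            have i1 := h_int w B (C * A) 0 s0 hw hw0 hwB le_rfl hs0.1 (hs0.2.trans hr.2)
            have i2 := h_int w B μ s0 t hw hw0 hwB hs0.1 hst htb.2
            have j1 := i1.2 (fun s hs => ih' s ⟨hs.1, hs.2.trans (hs0.2.trans hr.2)⟩ (by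
              rw [← hs0K]; exact hKmono s s0 hs.1.le hs.2 (hs0.2.trans hr.2)))
            have j2 := i2.2 (fun s hs => hle_μ s ⟨lt_of_le_of_lt hs0.1 hs.1, hs.2.trans ht.2⟩)
            have j3 := intervalIntegral.integral_add_adjacent_intervals i1.1 i2.1
            have j4 := hwi t htb
            rw [← j3] at j4
            have j5 := hKadd s0 t hs0.1 hst htb.2
            have j6 := hKmono t r ht.1.le ht.2 hr.2
            have j7 : (∫ s in s0..t, k s) ≤ 1 / 2 := by
              push_cast at hKr
              linarith
            have j8 : (∫ s in (0:ℝ)..s0, k s) ≤ K b := hKmono s0 b hs0.1 (hs0.2.trans hr.2) le_rfl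
            have j9 : μ * (∫ s in s0..t, k s) ≤ μ * (1 / 2) := mul_le_mul_of_nonneg_left j7 hμ0
            have j10 : C * A * (∫ s in (0:ℝ)..s0, k s) ≤ C * A * K b :=
              mul_le_mul_of_nonneg_left j8 e2
            nlinarith
        have hμle : μ ≤ (1 + C * K b + C) * A + μ / 2 := by
          apply csSup_le
          · exact ⟨w r, r, ⟨hr.1, le_rfl⟩, rfl⟩
          · rintro _ ⟨t, ht, rfl⟩
            exact key t ht
        have := hle_μ r ⟨hr.1, le_rfl⟩
        nlinarith
  obtain ⟨n, hn⟩ := exists_nat_ge (2 * K b)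
  obtain ⟨C, hC, h⟩ := main n
  refine ⟨C, hC, ?_⟩
  intro w A B hA hw hw0 hwB hwi r hr
  refine h w A B hA hw hw0 hwB hwi r hr ?_
  have := hKmono r b hr.1.le hr.2 le_rfl
  linarith


/-! ### The core a priori estimate for (inhomogeneous) regular solutions -/

/-- Solution of the (inhomogeneous) radial equation with prescribed leading behaviour at zero. -/
def AuxSol (V : ℝ → ℝ) (ℓ : ℕ) (E α : ℝ) (g y y' : ℝ → ℝ) : Prop :=
  (∀ r, 0 < r → HasDerivAt y (y' r) r) ∧
  (∀ r, 0 < r → HasDerivAt y' (((ℓ : ℝ) * (ℓ + 1) / r ^ 2 + V r - E) * y r + g r) r) ∧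
  Tendsto (fun r => y r / r ^ (ℓ + 1)) (𝓝[>] 0) (𝓝 α)

theorem aux_abs_sub_le (g g' φ : ℝ → ℝ) (a b : ℝ) (hab : a ≤ b)
    (hg : ∀ x ∈ Icc a b, HasDerivAt g (g' x) x) (hφ : IntervalIntegrable φ volume a b)
    (hle : ∀ x ∈ Ioo a b, |g' x| ≤ φ x) : |g b - g a| ≤ ∫ s in a..b, φ s := by
  have hφ' : IntegrableOn φ (Icc a b) := by
    rw [integrableOn_Icc_iff_integrableOn_Ioc]
    exact (intervalIntegrable_iff_integrableOn_Ioc_of_le hab).1 hφ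
  have hc : ContinuousOn g (Icc a b) := fun x hx => (hg x hx).continuousAt.continuousWithinAt
  rw [abs_le]
  constructor
  · have := intervalIntegral.sub_le_integral_of_hasDeriv_right_of_le (g := fun x => - g x)
      (g' := fun x => - g' x) hab hc.neg
      (fun x hx => (hg x (Ioo_subset_Icc_self hx)).neg.hasDerivWithinAt) hφ'
      (fun x hx => (neg_le_abs _).trans (hle x hx))
    linarith
  · exact intervalIntegral.sub_le_integral_of_hasDeriv_right_of_le hab hc
      (fun x hx => (hg x (Ioo_subset_Icc_self hx)).hasDerivWithinAt) hφ'
      (fun x hx => (le_abs_self _).trans (hle x hx))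

theorem aux_hasDerivAt_pow (n : ℕ) (r : ℝ) (hr : 0 < r) :
    HasDerivAt (fun x : ℝ => x ^ n) (n * r ^ n / r) r := by
  have h := hasDerivAt_pow n r
  refine h.congr_deriv ?_
  rcases n with _ | n
  · simp
  · simp only [Nat.add_sub_cancel, pow_succ]
    field_simp

theorem aux_core (V : ℝ → ℝ) (ℓ : ℕ)
    (hV : ∀ a : ℝ, 0 < a → IntegrableOn (fun r => r * |V r|) (Ioo 0 a))
    (b M : ℝ) (hb : 0 < b) (hM : 0 ≤ M) :
    ∃ C : ℝ, 0 ≤ C ∧ ∃ κ : ℝ → ℝ, Tendsto κ (𝓝[>] 0) (𝓝 0) ∧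
      ∀ (E α G : ℝ) (g y y' : ℝ → ℝ), |E| ≤ M → 0 ≤ G →
      AuxSol V ℓ E α g y y' → (∀ r ∈ Ioc 0 b, |g r| ≤ G * r ^ (ℓ + 1)) →
      ∀ r ∈ Ioc 0 b, |y r| ≤ C * (|α| + G) * r ^ (ℓ + 1) ∧ |y' r| ≤ C * (|α| + G) * r ^ ℓ ∧
        |y r / r ^ (ℓ + 1) - α| ≤ (|α| + G) * κ r := by
  set k : ℝ → ℝ := fun s => s * (|V s| + M) with hkdef
  have hk0 : ∀ s, 0 < s → 0 ≤ k s := fun s hs => by positivity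
  have hkint : IntervalIntegrable k volume 0 b := by
    have h1 : IntervalIntegrable (fun r => r * |V r|) volume 0 b := by
      rw [intervalIntegrable_iff_integrableOn_Ioc_of_le hb.le, integrableOn_Ioc_iff_integrableOn_Ioo]
      exact hV b hb
    have h2 : IntervalIntegrable (fun r : ℝ => r * M) volume 0 b :=
      (by fun_prop : Continuous fun r : ℝ => r * M).intervalIntegrable _ _
    refine (h1.add h2).congr ?_
    exact fun s _ => by simp [hkdef, mul_add]
  obtain ⟨C0, hC0, hgr⟩ := aux_gronwall (fun s => 2 * k s) b hb (hkint.const_mul 2)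
    (fun s hs => by have := hk0 s hs; positivity)
  set C1 := C0 * (1 + b ^ 2) with hC1
  have hC1' : 0 ≤ C1 := by positivity
  set K : ℝ → ℝ := fun r => ∫ s in (0:ℝ)..r, k s with hKdef
  have hKb : ∀ r ∈ Ioc 0 b, 0 ≤ K r ∧ K r ≤ K b := by
    intro r hr
    have i1 : IntervalIntegrable k volume 0 r := hkint.mono_set (by
      rw [uIcc_of_le hr.1.le, uIcc_of_le hb.le]; exact Icc_subset_Icc_right hr.2)
    have i2 : IntervalIntegrable k volume r b := hkint.mono_set (by
      rw [uIcc_of_le hr.2, uIcc_of_le hb.le]; exact Icc_subset_Icc_left hr.1.le)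
    have hp : ∀ x y, 0 ≤ x → x ≤ y → 0 ≤ ∫ s in x..y, k s := by
      intro x y hx hxy
      rw [intervalIntegral.integral_of_le hxy]
      exact setIntegral_nonneg measurableSet_Ioc fun s hs => hk0 s (lt_of_le_of_lt hx hs.1)
    have h3 := intervalIntegral.integral_add_adjacent_intervals i1 i2
    have h4 := hp r b hr.1.le hr.2
    refine ⟨hp 0 r le_rfl hr.1.le, ?_⟩
    simp only [hKdef]
    linarith
  have hKb0 := (hKb b ⟨hb, le_rfl⟩).1
  have hKlim : Tendsto K (𝓝[>] 0) (𝓝 0) := by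
    have h1 := intervalIntegral.continuousOn_primitive_interval' (a := 0) hkint left_mem_uIcc
    rw [uIcc_of_le hb.le] at h1
    have h2 := (h1 0 ⟨le_rfl, hb.le⟩).tendsto
    have h3 : (∫ s in (0:ℝ)..0, k s) = 0 := by simp
    rw [h3] at h2
    refine h2.mono_left ?_
    rw [nhdsWithin_le_iff]
    filter_upwards [Ioo_mem_nhdsGT hb] with s hs using ⟨hs.1.le, hs.2.le⟩
  refine ⟨C1 * (ℓ + 2 + K b) + b ^ 2, by positivity,
    fun r => 2 * (C1 * K r + r ^ 2), ?_, ?_⟩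
  · have h2 : Tendsto (fun r : ℝ => r ^ 2) (𝓝[>] 0) (𝓝 0) := by
      have : Tendsto (fun r : ℝ => r ^ 2) (𝓝 0) (𝓝 (0 ^ 2)) :=
        (by fun_prop : Continuous fun r : ℝ => r ^ 2).tendsto 0
      simpa using this.mono_left nhdsWithin_le_nhds
    have := ((hKlim.const_mul C1).add h2).const_mul 2
    simpa using this
  intro E α G g y y' hE hG hsol hg
  obtain ⟨hy, hy', hlim⟩ := hsol
  set w : ℝ → ℝ := fun r => y r / r ^ (ℓ + 1) with hw
  set z : ℝ → ℝ := fun r => y' r / r ^ ℓ - (ℓ + 1) * w r with hz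
  set u : ℝ → ℝ := fun r => r ^ ℓ * r * y' r - (ℓ + 1) * r ^ ℓ * y r with hu
  set x : ℝ → ℝ := fun r => (y' r / r ^ ℓ + ℓ * (y r / (r ^ ℓ * r))) / (2 * ℓ + 1) with hx
  have hdw : ∀ r, 0 < r → HasDerivAt w (z r / r) r := by
    intro r hr
    have h := (hy r hr).div (aux_hasDerivAt_pow (ℓ + 1) r hr) (by positivity)
    refine h.congr_deriv ?_
    simp only [hz, hw, pow_succ]
    push_cast
    field_simp
  have hdu : ∀ r, 0 < r → HasDerivAt u (r ^ ℓ * r * ((V r - E) * y r + g r)) r := by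
    intro r hr
    have h := (((aux_hasDerivAt_pow ℓ r hr).mul (hasDerivAt_id r)).mul (hy' r hr)).sub
      (((aux_hasDerivAt_pow ℓ r hr).const_mul ((ℓ : ℝ) + 1)).mul (hy r hr))
    refine h.congr_deriv ?_
    simp only [id, Pi.mul_apply]
    field_simp
    ring
  have hdx : ∀ r, 0 < r →
      HasDerivAt x (r * ((V r - E) * w r + g r / (r ^ ℓ * r)) / (2 * ℓ + 1)) r := by
    intro r hr
    have hne : r ^ ℓ * r ≠ 0 := by positivity
    have h := (((hy' r hr).div (aux_hasDerivAt_pow ℓ r hr) (by positivity)).add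
      (((hy r hr).div ((aux_hasDerivAt_pow ℓ r hr).mul (hasDerivAt_id r)) hne).const_mul
        (ℓ : ℝ))).div_const (2 * (ℓ : ℝ) + 1)
    refine h.congr_deriv ?_
    simp only [id, Pi.mul_apply, hw, pow_succ]
    field_simp
    ring
  have hxw : ∀ r, 0 < r → x r = w r + z r / (2 * ℓ + 1) := by
    intro r hr
    simp only [hx, hz, hw, pow_succ]
    field_simp
    ring
  have huz : ∀ r, 0 < r → u r = r ^ (2 * ℓ + 1) * z r := by
    intro r hr
    simp only [hu, hz, hw, pow_succ, two_mul, pow_add]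
    field_simp
  have hwcont : ContinuousOn w (Ioi 0) := fun r hr => (hdw r hr).continuousAt.continuousWithinAt
  obtain ⟨B, hB⟩ : ∃ B, ∀ r ∈ Ioc 0 b, |w r| ≤ B := by
    have h1 : ∀ᶠ r in 𝓝[>] (0:ℝ), |w r| < |α| + 1 :=
      (hlim.abs).eventually (gt_mem_nhds (by linarith))
    obtain ⟨δ, hδ, hδ'⟩ := mem_nhdsGT_iff_exists_Ioo_subset.1 h1
    have hδ0 : 0 < δ := hδ
    obtain ⟨B, hB⟩ := (isCompact_Icc (a := δ / 2) (b := b)).exists_bound_of_continuousOn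
      (hwcont.mono (fun s hs => lt_of_lt_of_le (by positivity) hs.1))
    refine ⟨max B (|α| + 1), fun r hr => ?_⟩
    by_cases h : r < δ
    · exact le_max_of_le_right (hδ' ⟨hr.1, h⟩ : |w r| < |α| + 1).le
    · refine le_max_of_le_left (hB r ⟨?_, hr.2⟩)
      push Not at h
      linarith
  have hwm : AEStronglyMeasurable (fun s => |w s|) (volume.restrict (Ioc 0 b)) := by
    refine ContinuousOn.aestronglyMeasurable ?_ measurableSet_Ioc
    exact (hwcont.mono (fun s hs => hs.1)).abs
  have hkw : IntervalIntegrable (fun s => k s * |w s|) volume 0 b := by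
    rw [intervalIntegrable_iff_integrableOn_Ioc_of_le hb.le] at hkint ⊢
    refine Integrable.mul_bdd (c := B) hkint hwm ?_
    rw [ae_restrict_iff' measurableSet_Ioc]
    exact ae_of_all _ fun s hs => by rw [Real.norm_eq_abs, abs_abs]; exact hB s hs
  set φ : ℝ → ℝ := fun s => k s * |w s| + G * s with hφ
  have hφint : IntervalIntegrable φ volume 0 b := hkw.add
    ((by fun_prop : Continuous fun s : ℝ => G * s).intervalIntegrable _ _)
  have hφ0 : ∀ s, 0 < s → 0 ≤ φ s := fun s hs => by
    have := hk0 s hs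
    simp only [hφ]; positivity
  have hsub : ∀ f : ℝ → ℝ, IntervalIntegrable f volume 0 b → ∀ p q, 0 ≤ p → p ≤ q → q ≤ b →
      IntervalIntegrable f volume p q := by
    intro f hf p q hp hpq hq
    apply hf.mono_set
    rw [uIcc_of_le hpq, uIcc_of_le hb.le]
    exact Icc_subset_Icc hp hq
  have hφle : ∀ p q, 0 ≤ p → p ≤ q → q ≤ b → ∫ s in p..q, φ s ≤ ∫ s in (0:ℝ)..q, φ s := by
    intro p q hp hpq hq
    have h3 := intervalIntegral.integral_add_adjacent_intervals
      (hsub φ hφint 0 p le_rfl hp (hpq.trans hq)) (hsub φ hφint p q hp hpq hq)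
    have h4 : 0 ≤ ∫ s in (0:ℝ)..p, φ s := by
      rw [intervalIntegral.integral_of_le hp]
      exact setIntegral_nonneg measurableSet_Ioc fun s hs => hφ0 s hs.1
    linarith
  have hpb : ∀ r ∈ Ioc 0 b, r * |(V r - E) * w r + g r / (r ^ ℓ * r)| ≤ φ r := by
    intro r hr
    have hr0 := hr.1
    have h1 : |g r / (r ^ ℓ * r)| ≤ G := by
      rw [abs_div, abs_of_pos (by positivity : 0 < r ^ ℓ * r), div_le_iff₀ (by positivity)]
      have := hg r hr
      rwa [pow_succ] at this
    have h2 : |(V r - E) * w r| ≤ (|V r| + M) * |w r| := by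
      rw [abs_mul]
      refine mul_le_mul_of_nonneg_right ?_ (abs_nonneg _)
      exact (abs_sub _ _).trans (by linarith)
    have h3 := abs_add_le ((V r - E) * w r) (g r / (r ^ ℓ * r))
    calc r * |(V r - E) * w r + g r / (r ^ ℓ * r)| ≤ r * ((|V r| + M) * |w r| + G) := by
          refine mul_le_mul_of_nonneg_left ?_ hr0.le
          linarith
      _ = φ r := by simp only [hφ, hkdef]; ring
  have hl1 : (1:ℝ) ≤ 2 * ℓ + 1 := by
    have : (0:ℝ) ≤ ℓ := by positivity
    linarith
  have hxi : ∀ η > 0, ∃ ξ, 0 < ξ ∧ ξ < η ∧ |z ξ| ≤ η ∧ |w ξ - α| ≤ η := by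
    intro η hη
    have h1 : ∀ᶠ r in 𝓝[>] (0:ℝ), |w r - α| < η / 4 := by
      have := (hlim.sub_const α).abs
      simp only [sub_self, abs_zero] at this
      exact this.eventually (gt_mem_nhds (by positivity))
    obtain ⟨δ, hδ, hδ'⟩ := mem_nhdsGT_iff_exists_Ioo_subset.1 h1
    have hδ0 : 0 < δ := hδ
    set r := min δ η / 4 with hr
    have hmin : 0 < min δ η := lt_min hδ0 hη
    have hr0 : 0 < r := by positivity
    have hrδ : 4 * r ≤ δ := by rw [hr]; have := min_le_left δ η; linarith
    have hrη : 4 * r ≤ η := by rw [hr]; have := min_le_right δ η; linarith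
    obtain ⟨ξ, hξ, hξ'⟩ := exists_hasDerivAt_eq_slope w (fun s => z s / s) (by linarith : r < 2 * r)
      (hwcont.mono fun s hs => lt_of_lt_of_le hr0 hs.1)
      (fun s hs => hdw s (hr0.trans hs.1))
    have hξ0 : 0 < ξ := hr0.trans hξ.1
    have a1 : |w (2 * r) - α| < η / 4 := hδ' ⟨by linarith, by linarith⟩
    have a2 : |w r - α| < η / 4 := hδ' ⟨by linarith, by linarith⟩
    have a3 : |w ξ - α| < η / 4 := hδ' ⟨hξ0, by linarith [hξ.2]⟩
    have a4 : |w (2 * r) - w r| ≤ η / 2 := by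
      have := abs_sub (w (2 * r) - α) (w r - α)
      have e : w (2 * r) - α - (w r - α) = w (2 * r) - w r := by ring
      rw [e] at this
      linarith
    refine ⟨ξ, hξ0, by linarith [hξ.2], ?_, by linarith⟩
    have e : z ξ = ξ / r * (w (2 * r) - w r) := by
      have e2 : 2 * r - r = r := by ring
      rw [e2] at hξ'
      field_simp at hξ' ⊢
      linarith
    rw [e, abs_mul, abs_of_pos (by positivity)]
    have : ξ / r ≤ 2 := by rw [div_le_iff₀ hr0]; linarith [hξ.2]
    calc ξ / r * |w (2 * r) - w r| ≤ 2 * (η / 2) :=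
          mul_le_mul this a4 (abs_nonneg _) (by norm_num)
      _ = η := by ring
  have hXb : ∀ r ∈ Ioc 0 b, |x r - α| ≤ ∫ s in (0:ℝ)..r, φ s := by
    intro r hr
    refine le_of_forall_pos_le_add fun η hη => ?_
    obtain ⟨ξ, hξ0, hξη, hξz, hξw⟩ := hxi (min (η / 2) r) (lt_min (by positivity) hr.1)
    have m1 := min_le_left (η / 2) r
    have m2 := min_le_right (η / 2) r
    have hξr : ξ ≤ r := by linarith
    have h1 := aux_abs_sub_le x _ φ ξ r hξr (fun s hs => hdx s (lt_of_lt_of_le hξ0 hs.1))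
      (hsub φ hφint ξ r hξ0.le hξr hr.2) (fun s hs => by
        have hs0 : 0 < s := hξ0.trans hs.1
        rw [abs_div, abs_mul, abs_of_pos hs0, abs_of_pos (by linarith : (0:ℝ) < 2 * ℓ + 1)]
        refine (div_le_self (by positivity) hl1).trans (hpb s ⟨hs0, hs.2.le.trans hr.2⟩))
    have h2 := hφle ξ r hξ0.le hξr hr.2
    have h3 : |x ξ - α| ≤ η := by
      rw [hxw ξ hξ0]
      have h4 : |z ξ / (2 * ℓ + 1)| ≤ |z ξ| := by
        rw [abs_div, abs_of_pos (by linarith : (0:ℝ) < 2 * ℓ + 1)]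
        exact div_le_self (abs_nonneg _) hl1
      have h5 := abs_add_le (w ξ - α) (z ξ / (2 * ℓ + 1))
      have e : w ξ - α + z ξ / (2 * ℓ + 1) = w ξ + z ξ / (2 * ℓ + 1) - α := by ring
      rw [e] at h5
      linarith
    have h6 := abs_add_le (x r - x ξ) (x ξ - α)
    have e : x r - x ξ + (x ξ - α) = x r - α := by ring
    rw [e] at h6
    linarith
  have hZb : ∀ r ∈ Ioc 0 b, |z r| ≤ ∫ s in (0:ℝ)..r, φ s := by
    intro r hr
    refine le_of_forall_pos_le_add fun η hη => ?_
    obtain ⟨ξ, hξ0, hξη, hξz, hξw⟩ := hxi (min η r) (lt_min (by positivity) hr.1)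
    have m1 := min_le_left η r
    have m2 := min_le_right η r
    have hξr : ξ ≤ r := by linarith
    have hr0 := hr.1
    have h1 := aux_abs_sub_le u _ (fun s => r ^ (2 * ℓ + 1) * φ s) ξ r hξr
      (fun s hs => hdu s (lt_of_lt_of_le hξ0 hs.1))
      ((hsub φ hφint ξ r hξ0.le hξr hr.2).const_mul _) (fun s hs => by
        have hs0 : 0 < s := hξ0.trans hs.1
        have e : s ^ ℓ * s * ((V s - E) * y s + g s) =
            s ^ (2 * ℓ + 1) * (s * ((V s - E) * w s + g s / (s ^ ℓ * s))) := by
          simp only [hw, pow_succ, two_mul, pow_add]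
          field_simp
        rw [e, abs_mul, abs_mul, abs_of_pos hs0, abs_of_pos (by positivity : 0 < s ^ (2 * ℓ + 1))]
        refine mul_le_mul ?_ (hpb s ⟨hs0, hs.2.le.trans hr.2⟩) (by positivity) (by positivity)
        exact pow_le_pow_left₀ hs0.le hs.2.le _)
    rw [intervalIntegral.integral_const_mul] at h1
    have h2 := hφle ξ r hξ0.le hξr hr.2
    have hP : 0 < r ^ (2 * ℓ + 1) := by positivity
    have h3 : |u ξ| ≤ r ^ (2 * ℓ + 1) * η := by
      rw [huz ξ hξ0, abs_mul, abs_of_pos (by positivity)]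
      refine mul_le_mul (pow_le_pow_left₀ hξ0.le hξr _) (by linarith) (abs_nonneg _) hP.le
    have h6 := abs_add_le (u r - u ξ) (u ξ)
    rw [sub_add_cancel, huz r hr0, abs_mul, abs_of_pos hP] at h6
    rw [← huz r hr0] at h6
    have h7 : r ^ (2 * ℓ + 1) * (∫ s in ξ..r, φ s) ≤ r ^ (2 * ℓ + 1) * ∫ s in (0:ℝ)..r, φ s :=
      mul_le_mul_of_nonneg_left h2 hP.le
    have h8 : r ^ (2 * ℓ + 1) * |z r| ≤ r ^ (2 * ℓ + 1) * ((∫ s in (0:ℝ)..r, φ s) + η) := by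
      linarith
    exact le_of_mul_le_mul_left h8 hP
  have hWx : ∀ r ∈ Ioc 0 b, |w r - α| ≤ 2 * ∫ s in (0:ℝ)..r, φ s := by
    intro r hr
    have h1 := hXb r hr
    have h2 := hZb r hr
    have h3 := hxw r hr.1
    have h4 : |z r / (2 * ℓ + 1)| ≤ |z r| := by
      rw [abs_div, abs_of_pos (by linarith : (0:ℝ) < 2 * ℓ + 1)]
      exact div_le_self (abs_nonneg _) hl1
    have h5 := abs_sub (x r - α) (z r / (2 * ℓ + 1))
    have e : x r - α - z r / (2 * ℓ + 1) = w r - α := by rw [h3]; ring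
    rw [e] at h5
    linarith
  have hφK : ∀ r ∈ Ioc 0 b, ∫ s in (0:ℝ)..r, φ s = (∫ s in (0:ℝ)..r, k s * |w s|) + G * (r ^ 2 / 2) := by
    intro r hr
    simp only [hφ]
    rw [intervalIntegral.integral_add (hsub _ hkw 0 r le_rfl hr.1.le hr.2)
      ((by fun_prop : Continuous fun s : ℝ => G * s).intervalIntegrable _ _),
      intervalIntegral.integral_const_mul, integral_id]
    ring
  have hr2 : ∀ r ∈ Ioc 0 b, r ^ 2 ≤ b ^ 2 := fun r hr => pow_le_pow_left₀ hr.1.le hr.2 _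
  have hα0 := abs_nonneg α
  have hW : ∀ r ∈ Ioc 0 b, |w r| ≤ C1 * (|α| + G) := by
    intro r hr
    have h := hgr (fun s => |w s|) (|α| + b ^ 2 * G) B (by positivity) hwm
      (fun s _ => abs_nonneg _) hB (fun s hs => by
        have h1 := hWx s hs
        rw [hφK s hs] at h1
        have h2 : |w s| ≤ |w s - α| + |α| := by
          have := abs_add_le (w s - α) α
          rwa [sub_add_cancel] at this
        have e : ∀ t, 2 * k t * |w t| = 2 * (k t * |w t|) := fun t => by ring
        simp only [e]
        rw [intervalIntegral.integral_const_mul]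
        have h3 := mul_le_mul_of_nonneg_right (hr2 s hs) hG
        linarith) r hr
    refine h.trans ?_
    rw [hC1, mul_assoc]
    refine mul_le_mul_of_nonneg_left ?_ hC0
    have : 0 ≤ b ^ 2 * |α| := by positivity
    linarith
  have hI : ∀ r ∈ Ioc 0 b, ∫ s in (0:ℝ)..r, φ s ≤ (|α| + G) * (C1 * K r + r ^ 2) := by
    intro r hr
    rw [hφK r hr]
    have h1 : (∫ s in (0:ℝ)..r, k s * |w s|) ≤ ∫ s in (0:ℝ)..r, k s * (C1 * (|α| + G)) := by
      have i1 := hsub _ hkw 0 r le_rfl hr.1.le hr.2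
      have i2 := (hsub _ hkint 0 r le_rfl hr.1.le hr.2).mul_const (C1 * (|α| + G))
      rw [intervalIntegral.integral_of_le hr.1.le, intervalIntegral.integral_of_le hr.1.le]
      rw [intervalIntegrable_iff_integrableOn_Ioc_of_le hr.1.le] at i1 i2
      refine setIntegral_mono_on i1 i2 measurableSet_Ioc ?_
      intro s hs
      exact mul_le_mul_of_nonneg_left (hW s ⟨hs.1, hs.2.trans hr.2⟩) (hk0 s hs.1)
    rw [intervalIntegral.integral_mul_const] at h1
    have h2 : G * (r ^ 2 / 2) ≤ (|α| + G) * r ^ 2 := by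
      have e1 : 0 ≤ |α| * r ^ 2 := by positivity
      have e2 : 0 ≤ G * r ^ 2 := by positivity
      nlinarith
    have h3 : (∫ s in (0:ℝ)..r, k s) = K r := rfl
    rw [h3] at h1
    nlinarith
  intro r hr
  have hr0 := hr.1
  have hAG : 0 ≤ |α| + G := by positivity
  have hwr := hW r hr
  have hzr : |z r| ≤ (|α| + G) * (C1 * K b + b ^ 2) := by
    refine (hZb r hr).trans ((hI r hr).trans ?_)
    refine mul_le_mul_of_nonneg_left ?_ hAG
    have := mul_le_mul_of_nonneg_left (hKb r hr).2 hC1'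
    linarith [hr2 r hr]
  have hl0 : (0:ℝ) ≤ ℓ := by positivity
  refine ⟨?_, ?_, ?_⟩
  · have e : y r = w r * r ^ (ℓ + 1) := by simp only [hw]; field_simp
    rw [e, abs_mul, abs_of_pos (by positivity : 0 < r ^ (ℓ + 1))]
    refine mul_le_mul_of_nonneg_right (hwr.trans ?_) (by positivity)
    refine mul_le_mul_of_nonneg_right ?_ hAG
    have : 0 ≤ C1 * K b := by positivity
    have : 0 ≤ C1 * ℓ := by positivity
    nlinarith [sq_nonneg b]
  · have e : y' r = (z r + (ℓ + 1) * w r) * r ^ ℓ := by simp only [hz]; field_simp; ring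
    rw [e, abs_mul, abs_of_pos (by positivity : 0 < r ^ ℓ)]
    refine mul_le_mul_of_nonneg_right ?_ (by positivity)
    have h1 := abs_add_le (z r) ((ℓ + 1) * w r)
    rw [abs_mul, abs_of_pos (by positivity : (0:ℝ) < ℓ + 1)] at h1
    have h2 : ((ℓ:ℝ) + 1) * |w r| ≤ (ℓ + 1) * (C1 * (|α| + G)) :=
      mul_le_mul_of_nonneg_left hwr (by positivity)
    have h3 : 0 ≤ C1 * (|α| + G) := by positivity
    nlinarith
  · refine (hWx r hr).trans ?_
    have := hI r hr
    linarith


/-! ### Finite differences in the energy -/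

/-- `k`-th forward difference with step `h` in the energy variable. -/
def auxD (ψ : ℝ → ℝ → ℝ) : ℕ → ℝ → ℝ → ℝ → ℝ
  | 0, _, E => ψ E
  | k + 1, h, E => fun r => auxD ψ k h (E + h) r - auxD ψ k h E r

theorem auxD_sol (V : ℝ → ℝ) (ℓ : ℕ) (ψ dψ : ℝ → ℝ → ℝ)
    (hS : ∀ E, AuxSol V ℓ E 1 (fun _ => 0) (ψ E) (dψ E)) (k : ℕ) : ∀ h E : ℝ,
    AuxSol V ℓ E (if k = 0 then 1 else 0)
      (fun r => -((k : ℝ) * h) * auxD ψ (k - 1) h (E + h) r) (auxD ψ k h E) (auxD dψ k h E) := by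
  induction k with
  | zero =>
    intro h E
    have := hS E
    simpa [auxD] using this
  | succ k ih =>
    intro h E
    obtain ⟨a1, a2, a3⟩ := ih h (E + h)
    obtain ⟨b1, b2, b3⟩ := ih h E
    refine ⟨fun r hr => (a1 r hr).sub (b1 r hr), fun r hr => ?_, ?_⟩
    · refine ((a2 r hr).sub (b2 r hr)).congr_deriv ?_
      rcases k with _ | k
      · simp [auxD]
        ring
      · simp only [Nat.add_sub_cancel]
        rw [show auxD ψ (k + 1 + 1) h E r
          = auxD ψ (k + 1) h (E + h) r - auxD ψ (k + 1) h E r from rfl]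
        rw [show auxD ψ (k + 1) h (E + h) r
          = auxD ψ k h (E + h + h) r - auxD ψ k h (E + h) r from rfl]
        push_cast
        ring
    · have := a3.sub b3
      simp only [sub_self] at this
      simp only [Nat.add_eq_zero_iff, one_ne_zero, and_false, if_false]
      refine this.congr fun r => ?_
      simp only [auxD]
      ring

theorem auxD_bound (V : ℝ → ℝ) (ℓ : ℕ)
    (hV : ∀ a : ℝ, 0 < a → IntegrableOn (fun r => r * |V r|) (Ioo 0 a))
    (ψ dψ : ℝ → ℝ → ℝ)
    (hS : ∀ E, AuxSol V ℓ E 1 (fun _ => 0) (ψ E) (dψ E)) (b : ℝ) (hb : 0 < b) (k : ℕ) :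
    ∀ M : ℝ, 0 ≤ M → ∃ C : ℝ, 0 ≤ C ∧ ∀ E h : ℝ, |E| ≤ M → |h| ≤ 1 → ∀ r ∈ Ioc 0 b,
      |auxD ψ k h E r| ≤ C * |h| ^ k * r ^ (ℓ + 1) ∧ |auxD dψ k h E r| ≤ C * |h| ^ k * r ^ ℓ := by
  induction k with
  | zero =>
    intro M hM
    obtain ⟨C, hC, κ, -, hc⟩ := aux_core V ℓ hV b M hb hM
    refine ⟨C, hC, fun E h hE hh r hr => ?_⟩
    have := hc E 1 0 _ _ _ hE le_rfl (hS E) (fun s _ => by simp) r hr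
    simp only [abs_one, add_zero, mul_one] at this
    simpa [auxD] using ⟨this.1, this.2.1⟩
  | succ k ih =>
    intro M hM
    obtain ⟨C, hC, κ, -, hc⟩ := aux_core V ℓ hV b M hb hM
    obtain ⟨C', hC', ih⟩ := ih (M + 1) (by linarith)
    refine ⟨C * ((k + 1) * C'), by positivity, fun E h hE hh r hr => ?_⟩
    have hEh : |E + h| ≤ M + 1 := (abs_add_le _ _).trans (by linarith)
    have hG : 0 ≤ ((k:ℝ) + 1) * C' * |h| ^ (k + 1) := by positivity
    have := hc E 0 (((k:ℝ) + 1) * C' * |h| ^ (k + 1)) _ _ _ hE hG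
      (by simpa using auxD_sol V ℓ ψ dψ hS (k + 1) h E) (fun s hs => by
        have h1 := (ih (E + h) h hEh hh s hs).1
        simp only [abs_mul, abs_neg]
        rw [abs_of_nonneg (by positivity : (0:ℝ) ≤ (k:ℝ) + 1)]
        calc ((k:ℝ) + 1) * |h| * |auxD ψ k h (E + h) s|
            ≤ ((k:ℝ) + 1) * |h| * (C' * |h| ^ k * s ^ (ℓ + 1)) :=
              mul_le_mul_of_nonneg_left h1 (by positivity)
          _ = _ := by ring) r hr
    simp only [abs_zero, zero_add] at this
    refine ⟨this.1.trans (le_of_eq (by ring)), this.2.1.trans (le_of_eq (by ring))⟩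

theorem aux_lower (V : ℝ → ℝ) (ℓ : ℕ)
    (hV : ∀ a : ℝ, 0 < a → IntegrableOn (fun r => r * |V r|) (Ioo 0 a))
    (ψ dψ : ℝ → ℝ → ℝ)
    (hS : ∀ E, AuxSol V ℓ E 1 (fun _ => 0) (ψ E) (dψ E)) (M : ℝ) (hM : 0 ≤ M) :
    ∃ δ > 0, ∀ E, |E| ≤ M → ∀ r ∈ Ioo 0 δ, r ^ (ℓ + 1) / 2 ≤ ψ E r := by
  obtain ⟨C, hC, κ, hκ, hc⟩ := aux_core V ℓ hV 1 M one_pos hM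
  have h1 : ∀ᶠ r in 𝓝[>] (0:ℝ), κ r < 1 / 2 := hκ.eventually (gt_mem_nhds (by norm_num))
  obtain ⟨δ, hδ, hδ'⟩ := mem_nhdsGT_iff_exists_Ioo_subset.1 h1
  have hδ0 : 0 < δ := hδ
  refine ⟨min δ 1, lt_min hδ0 one_pos, fun E hE r hr => ?_⟩
  have h2 := (hc E 1 0 _ _ _ hE le_rfl (hS E) (fun s _ => by simp) r
    ⟨hr.1, (hr.2.trans_le (min_le_right _ _)).le⟩).2.2
  have h3 : κ r < 1 / 2 := hδ' ⟨hr.1, hr.2.trans_le (min_le_left _ _)⟩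
  simp only [abs_one, add_zero, one_mul] at h2
  have h4 := (abs_le.1 h2).1
  have hr0 := hr.1
  have h5 : 1 / 2 ≤ ψ E r / r ^ (ℓ + 1) := by linarith
  rw [le_div_iff₀ (by positivity)] at h5
  linarith

/-- Bounds for solutions and their energy increments. -/
theorem aux_bounds (V : ℝ → ℝ) (ℓ : ℕ)
    (hV : ∀ a : ℝ, 0 < a → IntegrableOn (fun r => r * |V r|) (Ioo 0 a))
    (ψ dψ : ℝ → ℝ → ℝ)
    (hS : ∀ E, AuxSol V ℓ E 1 (fun _ => 0) (ψ E) (dψ E)) (b M : ℝ) (hb : 0 < b) (hM : 0 ≤ M) :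
    ∃ C : ℝ, 0 < C ∧ ∀ E, |E| ≤ M → ∀ r ∈ Ioc 0 b,
      |ψ E r| ≤ C ∧ |dψ E r| ≤ C ∧ |ψ E r| ≤ C * r ∧
      ∀ E', |E' - E| ≤ 1 → |ψ E' r - ψ E r| ≤ C * |E' - E| ∧ |dψ E' r - dψ E r| ≤ C * |E' - E| := by
  obtain ⟨C0, hC0, h0⟩ := auxD_bound V ℓ hV ψ dψ hS b hb 0 M hM
  obtain ⟨C1, hC1, h1⟩ := auxD_bound V ℓ hV ψ dψ hS b hb 1 M hM
  set B := (max b 1) ^ (ℓ + 1) with hB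
  have hm1 : 1 ≤ max b 1 := le_max_right _ _
  have hB0 : 0 < B := by positivity
  have hrB : ∀ r ∈ Ioc 0 b, ∀ j ≤ ℓ + 1, r ^ j ≤ B := by
    intro r hr j hj
    calc r ^ j ≤ (max b 1) ^ j := pow_le_pow_left₀ hr.1.le (hr.2.trans (le_max_left _ _)) _
      _ ≤ B := pow_le_pow_right₀ hm1 hj
  refine ⟨(C0 + C1 + 1) * B, by positivity, fun E hE r hr => ?_⟩
  have hr0 := hr.1
  have a := h0 E 0 hE (by simp) r hr
  simp only [auxD, pow_zero, mul_one] at a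
  have p1 := hrB r hr (ℓ + 1) le_rfl
  have p2 := hrB r hr ℓ (by omega)
  have q : ∀ c x : ℝ, 0 ≤ c → x ≤ B → (c ≤ C0 ∨ c ≤ C1) → c * x ≤ (C0 + C1 + 1) * B := by
    intro c x hc hx hcc
    calc c * x ≤ c * B := mul_le_mul_of_nonneg_left hx hc
      _ ≤ _ := by
        refine mul_le_mul_of_nonneg_right ?_ hB0.le
        rcases hcc with h | h <;> linarith
  refine ⟨a.1.trans (q _ _ hC0 p1 (Or.inl le_rfl)), a.2.trans (q _ _ hC0 p2 (Or.inl le_rfl)), ?_, ?_⟩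
  · have := a.1
    rw [pow_succ, ← mul_assoc] at this
    exact this.trans (mul_le_mul_of_nonneg_right (q _ _ hC0 p2 (Or.inl le_rfl)) hr0.le)
  · intro E' hE'
    have d := h1 E (E' - E) hE hE' r hr
    simp only [auxD, add_sub_cancel, pow_one] at d
    have hn := abs_nonneg (E' - E)
    constructor
    · refine d.1.trans ?_
      have := mul_le_mul_of_nonneg_right (q _ _ hC1 p1 (Or.inr le_rfl)) hn
      linarith
    · refine d.2.trans ?_
      have := mul_le_mul_of_nonneg_right (q _ _ hC1 p2 (Or.inr le_rfl)) hn
      linarith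


/-! ### Wronskians, simplicity of zeros, measurability of the potential -/

theorem aux_ii (f : ℝ → ℝ) (R C : ℝ) (hR : 0 ≤ R) (hf : ContinuousOn f (Ioi 0))
    (hC : ∀ s ∈ Ioc 0 R, |f s| ≤ C) : IntervalIntegrable f volume 0 R := by
  rw [intervalIntegrable_iff_integrableOn_Ioc_of_le hR]
  refine Integrable.of_bound
    ((hf.mono fun s hs => hs.1).aestronglyMeasurable measurableSet_Ioc) C ?_
  rw [ae_restrict_iff' measurableSet_Ioc]
  exact ae_of_all _ hC

theorem aux_cont {V : ℝ → ℝ} {ℓ : ℕ} {E α : ℝ} {g y y' : ℝ → ℝ} (h : AuxSol V ℓ E α g y y') :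
    ContinuousOn y (Ioi 0) ∧ ContinuousOn y' (Ioi 0) :=
  ⟨fun r hr => (h.1 r hr).continuousAt.continuousWithinAt,
    fun r hr => (h.2.1 r hr).continuousAt.continuousWithinAt⟩

theorem aux_wronskian (Va Vb : ℝ → ℝ) (ℓ : ℕ)
    (hVa : ∀ a : ℝ, 0 < a → IntegrableOn (fun r => r * |Va r|) (Ioo 0 a))
    (hVb : ∀ a : ℝ, 0 < a → IntegrableOn (fun r => r * |Vb r|) (Ioo 0 a))
    (ψa dψa ψb dψb : ℝ → ℝ → ℝ)
    (hSa : ∀ E, AuxSol Va ℓ E 1 (fun _ => 0) (ψa E) (dψa E))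
    (hSb : ∀ E, AuxSol Vb ℓ E 1 (fun _ => 0) (ψb E) (dψb E)) (Ea Eb R : ℝ) (hR : 0 < R)
    (h_int : IntervalIntegrable (fun s => (Vb s - Va s + (Ea - Eb)) * (ψa Ea s * ψb Eb s))
      volume 0 R) :
    ψa Ea R * dψb Eb R - dψa Ea R * ψb Eb R =
      ∫ s in (0:ℝ)..R, (Vb s - Va s + (Ea - Eb)) * (ψa Ea s * ψb Eb s) := by
  obtain ⟨Ca, hCa, ha⟩ := aux_bounds Va ℓ hVa ψa dψa hSa 1 |Ea| one_pos (abs_nonneg _)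
  obtain ⟨Cb, hCb, hb⟩ := aux_bounds Vb ℓ hVb ψb dψb hSb 1 |Eb| one_pos (abs_nonneg _)
  set W : ℝ → ℝ := fun r => ψa Ea r * dψb Eb r - dψa Ea r * ψb Eb r with hW
  have hd : ∀ r, 0 < r →
      HasDerivAt W ((Vb r - Va r + (Ea - Eb)) * (ψa Ea r * ψb Eb r)) r := by
    intro r hr
    refine ((((hSa Ea).1 r hr).mul ((hSb Eb).2.1 r hr)).sub
      (((hSa Ea).2.1 r hr).mul ((hSb Eb).1 r hr))).congr_deriv ?_
    ring
  have hlim : Tendsto W (𝓝[>] 0) (𝓝 0) := by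
    have h1 : Tendsto (fun r : ℝ => 2 * Ca * Cb * r) (𝓝[>] 0) (𝓝 0) := by
      have : Tendsto (fun r : ℝ => 2 * Ca * Cb * r) (𝓝 0) (𝓝 (2 * Ca * Cb * 0)) :=
        (by fun_prop : Continuous fun r : ℝ => 2 * Ca * Cb * r).tendsto 0
      simpa using this.mono_left nhdsWithin_le_nhds
    refine squeeze_zero_norm' ?_ h1
    filter_upwards [Ioo_mem_nhdsGT (one_pos : (0:ℝ) < 1)] with r hr
    have hr' : r ∈ Ioc (0:ℝ) 1 := ⟨hr.1, hr.2.le⟩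
    obtain ⟨a1, a2, a3, -⟩ := ha Ea le_rfl r hr'
    obtain ⟨b1, b2, b3, -⟩ := hb Eb le_rfl r hr'
    have hr0 := hr.1
    rw [Real.norm_eq_abs]
    have e1 : |ψa Ea r * dψb Eb r| ≤ Ca * r * Cb := by
      rw [abs_mul]; exact mul_le_mul a3 b2 (abs_nonneg _) (by positivity)
    have e2 : |dψa Ea r * ψb Eb r| ≤ Ca * (Cb * r) := by
      rw [abs_mul]; exact mul_le_mul a2 b3 (abs_nonneg _) (by positivity)
    have e3 := abs_sub (ψa Ea r * dψb Eb r) (dψa Ea r * ψb Eb r)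
    simp only [hW]
    linarith
  have := intervalIntegral.integral_eq_sub_of_hasDerivAt_of_tendsto hR
    (fun x hx => hd x hx.1) h_int hlim
    ((hd R hR).continuousAt.tendsto.mono_left nhdsWithin_le_nhds)
  rw [this, sub_zero]

theorem aux_ii_prod (V : ℝ → ℝ) (ℓ : ℕ)
    (hV : ∀ a : ℝ, 0 < a → IntegrableOn (fun r => r * |V r|) (Ioo 0 a))
    (ψ dψ : ℝ → ℝ → ℝ)
    (hS : ∀ E, AuxSol V ℓ E 1 (fun _ => 0) (ψ E) (dψ E))
    (E E' R : ℝ) (hR : 0 < R) :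
    IntervalIntegrable (fun s => ψ E s * ψ E' s) volume 0 R := by
  obtain ⟨C, hC, h⟩ := aux_bounds V ℓ hV ψ dψ hS R (max |E| |E'|) hR
    (le_max_of_le_left (abs_nonneg _))
  refine aux_ii _ R (C * C) hR.le ((aux_cont (hS E)).1.mul (aux_cont (hS E')).1) ?_
  intro s hs
  rw [abs_mul]
  exact mul_le_mul (h E (le_max_left _ _) s hs).1 (h E' (le_max_right _ _) s hs).1
    (abs_nonneg _) hC.le

theorem aux_wronskian_same (V : ℝ → ℝ) (ℓ : ℕ)
    (hV : ∀ a : ℝ, 0 < a → IntegrableOn (fun r => r * |V r|) (Ioo 0 a))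
    (ψ dψ : ℝ → ℝ → ℝ)
    (hS : ∀ E, AuxSol V ℓ E 1 (fun _ => 0) (ψ E) (dψ E))
    (E E' R : ℝ) (hR : 0 < R) :
    ψ E R * dψ E' R - dψ E R * ψ E' R = (E - E') * ∫ s in (0:ℝ)..R, ψ E s * ψ E' s := by
  have h := aux_wronskian V V ℓ hV hV ψ dψ ψ dψ hS hS E E' R hR (by
    simp only [sub_self, zero_add]
    exact (aux_ii_prod V ℓ hV ψ dψ hS E E' R hR).const_mul _)
  simp only [sub_self, zero_add] at h
  rw [h, intervalIntegral.integral_const_mul]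

theorem aux_N_lower (V : ℝ → ℝ) (ℓ : ℕ)
    (hV : ∀ a : ℝ, 0 < a → IntegrableOn (fun r => r * |V r|) (Ioo 0 a))
    (ψ dψ : ℝ → ℝ → ℝ)
    (hS : ∀ E, AuxSol V ℓ E 1 (fun _ => 0) (ψ E) (dψ E))
    (M R : ℝ) (hM : 0 ≤ M) (hR : 0 < R) :
    ∃ c > 0, ∀ E, |E| ≤ M → ∀ R', R ≤ R' → c ≤ ∫ s in (0:ℝ)..R', ψ E s * ψ E s := by
  obtain ⟨δ, hδ, h⟩ := aux_lower V ℓ hV ψ dψ hS M hM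
  set m := min δ R with hm
  have hm0 : 0 < m := lt_min hδ hR
  refine ⟨∫ s in (0:ℝ)..m, (s ^ (ℓ + 1) / 2) * (s ^ (ℓ + 1) / 2), ?_, ?_⟩
  · refine intervalIntegral.intervalIntegral_pos_of_pos_on ?_ ?_ hm0
    · exact (by fun_prop : Continuous fun s : ℝ => (s ^ (ℓ + 1) / 2) * (s ^ (ℓ + 1) / 2)).intervalIntegrable _ _
    · intro s hs
      have := hs.1
      positivity
  · intro E hE R' hR'
    have hmR : m ≤ R' := (min_le_right _ _).trans hR'
    have i := aux_ii_prod V ℓ hV ψ dψ hS E E R' (hR.trans_le hR')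
    have i1 : IntervalIntegrable (fun s => ψ E s * ψ E s) volume 0 m := i.mono_set (by
      rw [uIcc_of_le hm0.le, uIcc_of_le (hR.trans_le hR').le]; exact Icc_subset_Icc_right hmR)
    have i2 : IntervalIntegrable (fun s => ψ E s * ψ E s) volume m R' := i.mono_set (by
      rw [uIcc_of_le hmR, uIcc_of_le (hR.trans_le hR').le]; exact Icc_subset_Icc_left hm0.le)
    rw [← intervalIntegral.integral_add_adjacent_intervals i1 i2]
    have h2 : 0 ≤ ∫ s in m..R', ψ E s * ψ E s :=
      intervalIntegral.integral_nonneg hmR fun s _ => mul_self_nonneg _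
    have h1 : (∫ s in (0:ℝ)..m, (s ^ (ℓ + 1) / 2) * (s ^ (ℓ + 1) / 2)) ≤
        ∫ s in (0:ℝ)..m, ψ E s * ψ E s := by
      refine intervalIntegral.integral_mono_on_of_le_Ioo hm0.le
        ((by fun_prop : Continuous fun s : ℝ =>
          (s ^ (ℓ + 1) / 2) * (s ^ (ℓ + 1) / 2)).intervalIntegrable _ _) i1 ?_
      intro s hs
      have hs0 := hs.1
      have := h E hE s ⟨hs.1, hs.2.trans_le (min_le_left _ _)⟩
      exact mul_le_mul this this (by positivity) (le_trans (by positivity) this)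
    linarith

theorem aux_int_diff (V : ℝ → ℝ) (ℓ : ℕ)
    (hV : ∀ a : ℝ, 0 < a → IntegrableOn (fun r => r * |V r|) (Ioo 0 a))
    (ψ dψ : ℝ → ℝ → ℝ)
    (hS : ∀ E, AuxSol V ℓ E 1 (fun _ => 0) (ψ E) (dψ E))
    (E R : ℝ) (hR : 0 < R) : ∃ C : ℝ, 0 < C ∧ ∀ E', |E' - E| ≤ 1 →
    ∀ R' ∈ Ioc 0 R, |(∫ s in (0:ℝ)..R', ψ E s * ψ E' s) - ∫ s in (0:ℝ)..R', ψ E s * ψ E s| ≤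
      C * |E' - E| := by
  obtain ⟨C, hC, h⟩ := aux_bounds V ℓ hV ψ dψ hS R |E| hR (abs_nonneg _)
  refine ⟨C * C * R, by positivity, fun E' hE' R' hR' => ?_⟩
  rw [← intervalIntegral.integral_sub (aux_ii_prod V ℓ hV ψ dψ hS E E' R' hR'.1)
    (aux_ii_prod V ℓ hV ψ dψ hS E E R' hR'.1)]
  have := intervalIntegral.norm_integral_le_of_norm_le_const (a := 0) (b := R')
    (f := fun s => ψ E s * ψ E' s - ψ E s * ψ E s) (C := C * (C * |E' - E|)) (by
    intro s hs
    rw [uIoc_of_le hR'.1.le] at hs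
    obtain ⟨a1, -, -, a2⟩ := h E le_rfl s ⟨hs.1, hs.2.trans hR'.2⟩
    rw [← mul_sub, Real.norm_eq_abs, abs_mul]
    exact mul_le_mul a1 (a2 E' hE').1 (abs_nonneg _) hC.le)
  rw [Real.norm_eq_abs, sub_zero, abs_of_pos hR'.1] at this
  refine this.trans ?_
  have := mul_le_mul_of_nonneg_left hR'.2 (by positivity : 0 ≤ C * (C * |E' - E|))
  linarith

theorem aux_simple (V : ℝ → ℝ) (ℓ : ℕ)
    (hV : ∀ a : ℝ, 0 < a → IntegrableOn (fun r => r * |V r|) (Ioo 0 a))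
    (ψ dψ : ℝ → ℝ → ℝ)
    (hS : ∀ E, AuxSol V ℓ E 1 (fun _ => 0) (ψ E) (dψ E))
    (E R : ℝ) (hR : 0 < R) (h0 : ψ E R = 0) : dψ E R ≠ 0 := by
  intro h1
  obtain ⟨c, hc, hc'⟩ := aux_N_lower V ℓ hV ψ dψ hS |E| R (abs_nonneg _) hR
  have hN := hc' E le_rfl R le_rfl
  obtain ⟨C, hC, h⟩ := aux_int_diff V ℓ hV ψ dψ hS E R hR
  set h' := min 1 (c / (2 * C)) with hh
  have hpos : 0 < h' := lt_min one_pos (by positivity)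
  have hle := min_le_right 1 (c / (2 * C))
  have w := aux_wronskian_same V ℓ hV ψ dψ hS E (E + h') R hR
  rw [h0, h1] at w
  have w2 : (∫ s in (0:ℝ)..R, ψ E s * ψ (E + h') s) = 0 := by
    have e : E - (E + h') ≠ 0 := by
      have : E - (E + h') = - h' := by ring
      rw [this]; exact neg_ne_zero.2 hpos.ne'
    simpa [hpos.ne'] using w.symm
  have h2 := h (E + h') (by rw [add_sub_cancel_left, abs_of_pos hpos]; exact min_le_left _ _) R ⟨hR, le_rfl⟩
  rw [w2, add_sub_cancel_left, abs_of_pos hpos, zero_sub, abs_neg, abs_of_pos (hc.trans_le hN)] at h2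
  rw [← hh, le_div_iff₀ (by positivity)] at hle
  linarith

theorem aux_meas (V : ℝ → ℝ) (ℓ : ℕ)
    (hV : ∀ a : ℝ, 0 < a → IntegrableOn (fun r => r * |V r|) (Ioo 0 a))
    (ψ dψ : ℝ → ℝ → ℝ)
    (hS : ∀ E, AuxSol V ℓ E 1 (fun _ => 0) (ψ E) (dψ E))
    : AEStronglyMeasurable V (volume.restrict (Ioi 0)) := by
  set Z : Set ℝ := {r | 0 < r ∧ ψ 0 r = 0} with hZ
  have hZc : Z.Countable := by
    have hd : DiscreteTopology Z := by
      rw [discreteTopology_subtype_iff]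
      intro x hx
      have := ((hS 0).1 x hx.1).eventually_ne (c := 0) (aux_simple V ℓ hV ψ dψ hS 0 x hx.1 hx.2)
      rw [← _root_.disjoint_iff]
      rw [Filter.disjoint_principal_right]
      filter_upwards [this] with y hy hyZ using hy hyZ.2
    exact Set.countable_coe_iff.1 (countable_of_Lindelof_of_discrete (X := Z))
  have hm1 : AEStronglyMeasurable (ψ 0) (volume.restrict (Ioi 0)) :=
    (aux_cont (hS 0)).1.aestronglyMeasurable measurableSet_Ioi
  have hm2 : AEMeasurable (fun r => deriv (dψ 0) r / ψ 0 r - (ℓ : ℝ) * (ℓ + 1) / r ^ 2)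
      (volume.restrict (Ioi 0)) :=
    ((measurable_deriv (dψ 0)).aemeasurable.div hm1.aemeasurable).sub
      (by fun_prop)
  refine hm2.aestronglyMeasurable.congr ?_
  have hnull : ∀ᵐ r ∂(volume.restrict (Ioi (0:ℝ))), r ∉ Z :=
    ae_restrict_of_ae (hZc.ae_notMem volume)
  filter_upwards [hnull, ae_restrict_mem measurableSet_Ioi] with r hr hr0
  have hr0' : (0:ℝ) < r := hr0
  have hne : ψ 0 r ≠ 0 := fun h => hr ⟨hr0, h⟩
  rw [((hS 0).2.1 r hr0).deriv]
  field_simp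
  ring



/-! ### The derivative of a line of zeros and the virial identity -/

theorem aux_joint_cont (V : ℝ → ℝ) (ℓ : ℕ)
    (hV : ∀ a : ℝ, 0 < a → IntegrableOn (fun r => r * |V r|) (Ioo 0 a))
    (ψ dψ : ℝ → ℝ → ℝ)
    (hS : ∀ E, AuxSol V ℓ E 1 (fun _ => 0) (ψ E) (dψ E)) (E0 R0 : ℝ) (hR0 : 0 < R0) :
    ContinuousAt (fun p : ℝ × ℝ => dψ p.1 p.2) (E0, R0) := by
  obtain ⟨C, hC, h⟩ := aux_bounds V ℓ hV ψ dψ hS (2 * R0) |E0| (by linarith) (abs_nonneg _)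
  have h1 : Tendsto (fun p : ℝ × ℝ => dψ E0 p.2) (𝓝 (E0, R0)) (𝓝 (dψ E0 R0)) :=
    ((hS E0).2.1 R0 hR0).continuousAt.tendsto.comp (continuous_snd.tendsto (E0, R0))
  have h2 : Tendsto (fun p : ℝ × ℝ => dψ p.1 p.2 - dψ E0 p.2) (𝓝 (E0, R0)) (𝓝 0) := by
    have h3 : Tendsto (fun p : ℝ × ℝ => C * |p.1 - E0|) (𝓝 (E0, R0)) (𝓝 0) := by
      have : Tendsto (fun p : ℝ × ℝ => C * |p.1 - E0|) (𝓝 (E0, R0)) (𝓝 (C * |E0 - E0|)) :=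
        (by fun_prop : Continuous fun p : ℝ × ℝ => C * |p.1 - E0|).tendsto (E0, R0)
      simpa using this
    refine squeeze_zero_norm' ?_ h3
    have e1 : ∀ᶠ p : ℝ × ℝ in 𝓝 (E0, R0), p.2 ∈ Ioo 0 (2 * R0) :=
      (continuous_snd.tendsto (E0, R0)).eventually
        (Ioo_mem_nhds hR0 (by simp only; linarith))
    have e2 : ∀ᶠ p : ℝ × ℝ in 𝓝 (E0, R0), p.1 ∈ Ioo (E0 - 1) (E0 + 1) :=
      (continuous_fst.tendsto (E0, R0)).eventually
        (Ioo_mem_nhds (by simp) (by simp))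
    filter_upwards [e1, e2] with p hp1 hp2
    refine ((h E0 le_rfl p.2 ⟨hp1.1, hp1.2.le⟩).2.2.2 p.1 ?_).2
    rw [abs_le]
    constructor <;> linarith [hp2.1, hp2.2]
  have := h2.add h1
  simpa [ContinuousAt] using this

theorem aux_rbar_deriv (V : ℝ → ℝ) (ℓ : ℕ)
    (hV : ∀ a : ℝ, 0 < a → IntegrableOn (fun r => r * |V r|) (Ioo 0 a))
    (ψ dψ : ℝ → ℝ → ℝ)
    (hS : ∀ E, AuxSol V ℓ E 1 (fun _ => 0) (ψ E) (dψ E)) (rb : ℝ → ℝ) (E0 : ℝ)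
    (hc : ContinuousAt rb E0) (hpos : ∀ᶠ E in 𝓝 E0, 0 < rb E ∧ ψ E (rb E) = 0)
    (hinj : ∀ᶠ E in 𝓝[≠] E0, rb E ≠ rb E0) :
    HasDerivAt rb (-(∫ s in (0:ℝ)..rb E0, ψ E0 s * ψ E0 s) / (dψ E0 (rb E0)) ^ 2) E0 := by
  set R0 := rb E0 with hR0
  have hR0pos : 0 < R0 := hpos.self_of_nhds.1
  have hψ0 : ψ E0 R0 = 0 := hpos.self_of_nhds.2
  have hne := aux_simple V ℓ hV ψ dψ hS E0 R0 hR0pos hψ0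
  obtain ⟨C, hC, hI⟩ := aux_int_diff V ℓ hV ψ dψ hS E0 (2 * R0) (by linarith)
  have hrb : Tendsto rb (𝓝[≠] E0) (𝓝 R0) := hc.tendsto.mono_left nhdsWithin_le_nhds
  have hrb' : Tendsto rb (𝓝[≠] E0) (𝓝[≠] R0) :=
    tendsto_nhdsWithin_iff.2 ⟨hrb, hinj⟩
  have hid : Tendsto (fun E : ℝ => E) (𝓝[≠] E0) (𝓝 E0) := tendsto_id.mono_left nhdsWithin_le_nhds
  have t1 : Tendsto (fun E => dψ E (rb E)) (𝓝[≠] E0) (𝓝 (dψ E0 R0)) :=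
    (aux_joint_cont V ℓ hV ψ dψ hS E0 R0 hR0pos).tendsto.comp (hid.prodMk_nhds hrb)
  have t2 : Tendsto (fun E => slope (ψ E0) R0 (rb E)) (𝓝[≠] E0) (𝓝 (dψ E0 R0)) :=
    ((hasDerivAt_iff_tendsto_slope.1 ((hS E0).1 R0 hR0pos))).comp hrb'
  have t3 : Tendsto (fun E => ∫ s in (0:ℝ)..rb E, ψ E0 s * ψ E0 s) (𝓝[≠] E0)
      (𝓝 (∫ s in (0:ℝ)..R0, ψ E0 s * ψ E0 s)) := by
    have i := aux_ii_prod V ℓ hV ψ dψ hS E0 E0 (2 * R0) (by linarith)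
    have h1 := intervalIntegral.continuousOn_primitive_interval' (a := 0) i left_mem_uIcc
    rw [uIcc_of_le (by linarith)] at h1
    have h2 := h1.continuousAt (x := R0) (Icc_mem_nhds hR0pos (by linarith))
    exact h2.tendsto.comp hrb
  have t4 : Tendsto (fun E => ∫ s in (0:ℝ)..rb E, ψ E0 s * ψ E s) (𝓝[≠] E0)
      (𝓝 (∫ s in (0:ℝ)..R0, ψ E0 s * ψ E0 s)) := by
    have h2 : Tendsto (fun E => (∫ s in (0:ℝ)..rb E, ψ E0 s * ψ E s) -
        ∫ s in (0:ℝ)..rb E, ψ E0 s * ψ E0 s) (𝓝[≠] E0) (𝓝 0) := by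
      have h3 : Tendsto (fun E : ℝ => C * |E - E0|) (𝓝[≠] E0) (𝓝 0) := by
        have : Tendsto (fun E : ℝ => C * |E - E0|) (𝓝 E0) (𝓝 (C * |E0 - E0|)) :=
          (by fun_prop : Continuous fun E : ℝ => C * |E - E0|).tendsto E0
        simpa using this.mono_left nhdsWithin_le_nhds
      refine squeeze_zero_norm' ?_ h3
      have e1 : ∀ᶠ E in 𝓝[≠] E0, rb E ∈ Ioo 0 (2 * R0) :=
        hrb.eventually (Ioo_mem_nhds hR0pos (by linarith))
      have e2 : ∀ᶠ E in 𝓝[≠] E0, E ∈ Ioo (E0 - 1) (E0 + 1) :=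
        hid.eventually (Ioo_mem_nhds (by simp) (by simp))
      filter_upwards [e1, e2] with E hE1 hE2
      refine hI E ?_ (rb E) ⟨hE1.1, hE1.2.le⟩
      rw [abs_le]
      constructor <;> linarith [hE2.1, hE2.2]
    simpa using h2.add t3
  rw [hasDerivAt_iff_tendsto_slope]
  have t5 := t4.neg.div (t2.mul t1) (mul_ne_zero hne hne)
  rw [← pow_two] at t5
  refine t5.congr' ?_
  have e1 := (t2.mul t1).eventually_ne (mul_ne_zero hne hne)
  have e2 : ∀ᶠ E in 𝓝[≠] E0, 0 < rb E ∧ ψ E (rb E) = 0 := hpos.filter_mono nhdsWithin_le_nhds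
  filter_upwards [e1, e2, hinj, self_mem_nhdsWithin] with E h1 h2 h3 h4
  have w := aux_wronskian_same V ℓ hV ψ dψ hS E0 E (rb E) h2.1
  rw [h2.2, mul_zero, sub_zero] at w
  simp only [Pi.div_apply]
  rw [div_eq_iff h1]
  have h3' : rb E - R0 ≠ 0 := sub_ne_zero.2 h3
  have h4' : E - E0 ≠ 0 := sub_ne_zero.2 h4
  rw [slope_def_field, slope_def_field, hψ0, sub_zero]
  field_simp
  have w' : ψ E0 (rb E) * dψ E (rb E) = (E0 - E) * ∫ s in (0:ℝ)..rb E, ψ E0 s * ψ E s := w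
  rw [mul_assoc (rb E - rb E0), w', ← hR0]
  ring

theorem aux_virial (V : ℝ → ℝ) (ℓ : ℕ)
    (hV : ∀ a : ℝ, 0 < a → IntegrableOn (fun r => r * |V r|) (Ioo 0 a))
    (ψ dψ : ℝ → ℝ → ℝ)
    (hS : ∀ E, AuxSol V ℓ E 1 (fun _ => 0) (ψ E) (dψ E)) (ε c E R : ℝ)
    (hVc : ∀ r ∈ Ioo 0 ε, V r = c) (hR : 0 < R) (hRε : R < ε) (h0 : ψ E R = 0) :
    R * (dψ E R) ^ 2 = 2 * (E - c) * ∫ s in (0:ℝ)..R, ψ E s * ψ E s := by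
  obtain ⟨C, hC, h⟩ := aux_bounds V ℓ hV ψ dψ hS 1 |E| one_pos (abs_nonneg _)
  set L : ℝ := (ℓ : ℝ) * (ℓ + 1) with hL
  have hL0 : 0 ≤ L := by positivity
  set T : ℝ → ℝ := fun r => r * (dψ E r * dψ E r) + (E - c) * (r * (ψ E r * ψ E r))
    - L * (ψ E r * ψ E r / r) - ψ E r * dψ E r with hT
  have hd : ∀ r, 0 < r → r < ε → HasDerivAt T (2 * (E - c) * (ψ E r * ψ E r)) r := by
    intro r hr hrε
    have d1 := (hS E).1 r hr
    have d2 := (hS E).2.1 r hr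
    refine (((((hasDerivAt_id r).mul (d2.mul d2)).add
      (((hasDerivAt_id r).mul (d1.mul d1)).const_mul (E - c))).sub
      (((d1.mul d1).div (hasDerivAt_id r) hr.ne').const_mul L)).sub (d1.mul d2)).congr_deriv ?_
    simp only [id, Pi.mul_apply, hVc r ⟨hr, hrε⟩, ← hL]
    field_simp
    ring
  have hlim : Tendsto T (𝓝[>] 0) (𝓝 0) := by
    set D := C ^ 2 * (2 + |E - c| + L) with hD
    have h1 : Tendsto (fun r : ℝ => D * r) (𝓝[>] 0) (𝓝 0) := by
      have : Tendsto (fun r : ℝ => D * r) (𝓝 0) (𝓝 (D * 0)) :=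
        (by fun_prop : Continuous fun r : ℝ => D * r).tendsto 0
      simpa using this.mono_left nhdsWithin_le_nhds
    refine squeeze_zero_norm' ?_ h1
    filter_upwards [Ioo_mem_nhdsGT (one_pos : (0:ℝ) < 1)] with r hr
    obtain ⟨a1, a2, a3, -⟩ := h E le_rfl r ⟨hr.1, hr.2.le⟩
    have hr0 := hr.1
    have b1 : |r * (dψ E r * dψ E r)| ≤ r * (C * C) := by
      rw [abs_mul, abs_mul, abs_of_pos hr0]
      gcongr
    have b2 : |(E - c) * (r * (ψ E r * ψ E r))| ≤ |E - c| * (r * (C * C)) := by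
      rw [abs_mul, abs_mul, abs_mul, abs_of_pos hr0]
      gcongr
    have b3 : |L * (ψ E r * ψ E r / r)| ≤ L * (r * (C * C)) := by
      rw [abs_mul L, abs_div, abs_mul (ψ E r), abs_of_pos hr0, abs_of_nonneg hL0]
      refine mul_le_mul_of_nonneg_left ?_ hL0
      rw [div_le_iff₀ hr0]
      calc |ψ E r| * |ψ E r| ≤ (C * r) * (C * r) := by gcongr
        _ = _ := by ring
    have b4 : |ψ E r * dψ E r| ≤ (C * r) * C := by
      rw [abs_mul]
      gcongr
    have s1 := abs_sub (r * (dψ E r * dψ E r) + (E - c) * (r * (ψ E r * ψ E r))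
      - L * (ψ E r * ψ E r / r)) (ψ E r * dψ E r)
    have s2 := abs_sub (r * (dψ E r * dψ E r) + (E - c) * (r * (ψ E r * ψ E r)))
      (L * (ψ E r * ψ E r / r))
    have s3 := abs_add_le (r * (dψ E r * dψ E r)) ((E - c) * (r * (ψ E r * ψ E r)))
    rw [Real.norm_eq_abs]
    simp only [hT, hD]
    nlinarith
  have := intervalIntegral.integral_eq_sub_of_hasDerivAt_of_tendsto hR
    (fun x hx => hd x hx.1 (hx.2.trans hRε))
    ((aux_ii_prod V ℓ hV ψ dψ hS E E R hR).const_mul (2 * (E - c))) hlim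
    ((hd R hR hRε).continuousAt.tendsto.mono_left nhdsWithin_le_nhds)
  rw [intervalIntegral.integral_const_mul] at this
  rw [this]
  simp only [hT, h0]
  ring


/-! ### Local asymptotics near a Lebesgue point -/

theorem aux_asym (f : ℝ → ℝ) (hf : Integrable f) (R : ℝ)
    (leb : Tendsto (fun d => d⁻¹ * ∫ s in (R - d)..R, |f s - f R|) (𝓝[>] 0) (𝓝 0))
    (u v : ℝ → ℝ) (G : ℝ → ℝ → ℝ) (κ l μ : ℝ) (hμ0 : 0 < μ)
    (hl : Tendsto (fun h => (v h - u h) / h) (𝓝[>] 0) (𝓝 l))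
    (hμ : Tendsto (fun h => (R - u h) / h) (𝓝[>] 0) (𝓝 μ))
    (huv : ∀ᶠ h in 𝓝[>] 0, u h ≤ v h ∧ v h ≤ R)
    (hG : ∀ᶠ h in 𝓝[>] 0, ContinuousOn (G h) (Icc (u h) (v h)))
    (hGk : ∀ δ > 0, ∀ᶠ h in 𝓝[>] (0:ℝ), ∀ s ∈ Icc (u h) (v h),
      |G h s - κ * (s - v h) ^ 2| ≤ δ * (s - v h) ^ 2) :
    Tendsto (fun h => (∫ s in (u h)..(v h), f s * G h s) / h ^ 3) (𝓝[>] 0)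
      (𝓝 (f R * κ * l ^ 3 / 3)) := by
  have hpos : ∀ᶠ h in 𝓝[>] (0:ℝ), 0 < h := self_mem_nhdsWithin
  have hid : Tendsto (fun h : ℝ => h) (𝓝[>] 0) (𝓝 0) := tendsto_id.mono_left nhdsWithin_le_nhds
  have hdpos : ∀ᶠ h in 𝓝[>] 0, 0 < R - u h := by
    filter_upwards [hμ.eventually_const_lt hμ0, hpos] with h h1 h2
    have := mul_pos h1 h2
    rwa [div_mul_cancel₀ _ h2.ne'] at this
  have hd0 : Tendsto (fun h => R - u h) (𝓝[>] 0) (𝓝 0) := by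
    have := hμ.mul hid
    rw [mul_zero] at this
    refine this.congr' ?_
    filter_upwards [hpos] with h h1
    rw [div_mul_cancel₀ _ h1.ne']
  have hd : Tendsto (fun h => R - u h) (𝓝[>] 0) (𝓝[>] 0) :=
    tendsto_nhdsWithin_iff.2 ⟨hd0, hdpos⟩
  -- the first error term
  have T1 : Tendsto (fun h => (∫ s in (u h)..(v h), (f s - f R) * G h s) / h ^ 3) (𝓝[>] 0)
      (𝓝 0) := by
    have b : Tendsto (fun h => (|κ| + 1) * (((R - u h) / h) ^ 3 *
        ((R - u h)⁻¹ * ∫ s in (R - (R - u h))..R, |f s - f R|))) (𝓝[>] 0) (𝓝 0) := by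
      have := ((hμ.pow 3).mul (leb.comp hd)).const_mul (|κ| + 1)
      simpa using this
    refine squeeze_zero_norm' ?_ b
    filter_upwards [hpos, hdpos, huv, hG, hGk 1 one_pos] with h h1 h2 h3 h4 h5
    rw [sub_sub_cancel, norm_div, norm_pow, Real.norm_of_nonneg h1.le]
    have key : ‖∫ s in (u h)..(v h), (f s - f R) * G h s‖
        ≤ (|κ| + 1) * (R - u h) ^ 2 * ∫ s in (u h)..R, |f s - f R| := by
      have ii : IntervalIntegrable (fun s => |f s - f R|) volume (u h) R :=
        (hf.intervalIntegrable.sub intervalIntegrable_const).abs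
      have ii' : IntervalIntegrable (fun s => (|κ| + 1) * (R - u h) ^ 2 * |f s - f R|)
        volume (u h) (v h) := (((hf.intervalIntegrable).sub intervalIntegrable_const).abs).const_mul _
      calc ‖∫ s in (u h)..(v h), (f s - f R) * G h s‖
          ≤ ∫ s in (u h)..(v h), (|κ| + 1) * (R - u h) ^ 2 * |f s - f R| := by
            refine intervalIntegral.norm_integral_le_of_norm_le h3.1 ?_ ii'
            refine Eventually.of_forall fun s hs => ?_
            rw [norm_mul, mul_comm, Real.norm_eq_abs, Real.norm_eq_abs]
            refine mul_le_mul_of_nonneg_right ?_ (abs_nonneg _)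
            have g := h5 s ⟨hs.1.le, hs.2⟩
            have g2 : |G h s| ≤ |κ| * (s - v h) ^ 2 + 1 * (s - v h) ^ 2 := by
              have := abs_add_le (G h s - κ * (s - v h) ^ 2) (κ * (s - v h) ^ 2)
              rw [sub_add_cancel, abs_mul κ, abs_of_nonneg (sq_nonneg (s - v h))] at this
              linarith
            have g3 : (s - v h) ^ 2 ≤ (R - u h) ^ 2 := by
              nlinarith [hs.1, hs.2, h3.1, h3.2]
            calc |G h s| ≤ (|κ| + 1) * (s - v h) ^ 2 := by linarith
              _ ≤ _ := by gcongr
        _ = (|κ| + 1) * (R - u h) ^ 2 * ∫ s in (u h)..(v h), |f s - f R| :=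
            intervalIntegral.integral_const_mul _ _
        _ ≤ _ := by
            refine mul_le_mul_of_nonneg_left ?_ (by positivity)
            exact intervalIntegral.integral_mono_interval le_rfl h3.1 h3.2
              (Eventually.of_forall fun s => abs_nonneg _) ii
    calc _ ≤ ((|κ| + 1) * (R - u h) ^ 2 * ∫ s in (u h)..R, |f s - f R|) / h ^ 3 := by gcongr
      _ = _ := by field_simp
  have T2 : Tendsto (fun h => (∫ s in (u h)..(v h), (G h s - κ * (s - v h) ^ 2)) / h ^ 3) (𝓝[>] 0)
      (𝓝 0) := by
    rw [Metric.tendsto_nhds]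
    intro ε hε
    have hM : 0 < (μ + 1) ^ 3 := by positivity
    filter_upwards [hpos, hdpos, huv, hG, hGk (ε / 2 / (μ + 1) ^ 3) (by positivity),
      hμ.eventually_lt_const (lt_add_one μ)] with h h1 h2 h3 h4 h5 h6
    rw [dist_zero_right, norm_div, norm_pow, Real.norm_of_nonneg h1.le]
    have key : ‖∫ s in (u h)..(v h), (G h s - κ * (s - v h) ^ 2)‖
        ≤ ε / 2 / (μ + 1) ^ 3 * (R - u h) ^ 2 * |v h - u h| := by
      refine intervalIntegral.norm_integral_le_of_norm_le_const fun s hs => ?_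
      rw [uIoc_of_le h3.1] at hs
      refine (h5 s ⟨hs.1.le, hs.2⟩).trans ?_
      have g3 : (s - v h) ^ 2 ≤ (R - u h) ^ 2 := by
        nlinarith [hs.1, hs.2, h3.1, h3.2]
      gcongr
    rw [abs_of_nonneg (by linarith)] at key
    have h7 : R - u h < (μ + 1) * h := by rwa [div_lt_iff₀ h1] at h6
    rw [div_lt_iff₀ (by positivity)]
    calc _ ≤ _ := key
      _ ≤ ε / 2 / (μ + 1) ^ 3 * ((μ + 1) * h) ^ 2 * ((μ + 1) * h) := by
        gcongr
        all_goals linarith [h3.2]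
      _ = ε / 2 * h ^ 3 := by field_simp
      _ < ε * h ^ 3 := by
        have : 0 < h ^ 3 := by positivity
        nlinarith
  have T3 := (T1.add (T2.const_mul (f R))).add ((hl.pow 3).const_mul (f R * κ / 3))
  rw [show f R * κ * l ^ 3 / 3 = 0 + f R * 0 + f R * κ / 3 * l ^ 3 by ring]
  refine T3.congr' ?_
  filter_upwards [hpos, huv, hG] with h h1 h3 h4
  have i1 : IntervalIntegrable (fun s => f s * G h s) volume (u h) (v h) :=
    hf.intervalIntegrable.mul_continuousOn (by rwa [uIcc_of_le h3.1])
  have i2 : IntervalIntegrable (G h) volume (u h) (v h) :=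
    ContinuousOn.intervalIntegrable (by rwa [uIcc_of_le h3.1])
  have i3 : IntervalIntegrable (fun s => κ * (s - v h) ^ 2) volume (u h) (v h) :=
    Continuous.intervalIntegrable (by fun_prop) _ _
  have e1 : ∫ s in (u h)..(v h), (f s - f R) * G h s =
      (∫ s in (u h)..(v h), f s * G h s) - f R * ∫ s in (u h)..(v h), G h s := by
    rw [← intervalIntegral.integral_const_mul, ← intervalIntegral.integral_sub i1 (i2.const_mul _)]
    simp only [sub_mul]
  have e2 : ∫ s in (u h)..(v h), (G h s - κ * (s - v h) ^ 2) =
      (∫ s in (u h)..(v h), G h s) - κ * ((v h - u h) ^ 3 / 3) := by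
    rw [intervalIntegral.integral_sub i2 i3, intervalIntegral.integral_const_mul]
    congr 2
    rw [intervalIntegral.integral_comp_sub_right (fun x => x ^ 2) (v h), integral_pow]
    norm_num
    ring
  rw [e1, e2, div_pow]
  field_simp
  ring


theorem aux_expand (V : ℝ → ℝ) (ℓ : ℕ)
    (hV : ∀ a : ℝ, 0 < a → IntegrableOn (fun r => r * |V r|) (Ioo 0 a))
    (ψ dψ : ℝ → ℝ → ℝ)
    (hS : ∀ E, AuxSol V ℓ E 1 (fun _ => 0) (ψ E) (dψ E)) (E0 R0 : ℝ) (hR0 : 0 < R0)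
    (δ : ℝ) (hδ : 0 < δ) :
    ∃ η > 0, ∀ E, |E - E0| < η → ∀ s v, |s - R0| < η → |v - R0| < η → ψ E v = 0 →
      |ψ E s - dψ E0 R0 * (s - v)| ≤ δ * |s - v| := by
  have h := aux_joint_cont V ℓ hV ψ dψ hS E0 R0 hR0
  rw [Metric.continuousAt_iff] at h
  obtain ⟨η, hη, h⟩ := h δ hδ
  refine ⟨min η R0, lt_min hη hR0, fun E hE s v hs hv h0 => ?_⟩
  have key : ∀ x ∈ Metric.ball R0 (min η R0), HasDerivWithinAt
      (fun x => ψ E x - dψ E0 R0 * x) (dψ E x - dψ E0 R0) (Metric.ball R0 (min η R0)) x := by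
    intro x hx
    rw [Metric.mem_ball, Real.dist_eq] at hx
    have hx0 : 0 < x := by
      have := (abs_lt.1 (hx.trans_le (min_le_right _ _))).1
      linarith
    refine HasDerivAt.hasDerivWithinAt ?_
    exact (((hS E).1 x hx0).sub ((hasDerivAt_id x).const_mul (dψ E0 R0))).congr_deriv (by simp)
  have bd : ∀ x ∈ Metric.ball R0 (min η R0), ‖dψ E x - dψ E0 R0‖ ≤ δ := by
    intro x hx
    rw [Metric.mem_ball] at hx
    have := h (x := (E, x)) (by
      rw [Prod.dist_eq]
      exact max_lt (by rw [Real.dist_eq]; exact hE.trans_le (min_le_left _ _))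
        (hx.trans_le (min_le_left _ _)))
    rw [Real.dist_eq] at this
    exact this.le
  have := (convex_ball R0 (min η R0)).norm_image_sub_le_of_norm_hasDerivWithin_le key bd
    (x := v) (y := s) (by rwa [Metric.mem_ball, Real.dist_eq])
    (by rwa [Metric.mem_ball, Real.dist_eq])
  rw [h0] at this
  simp only [Real.norm_eq_abs] at this
  refine le_trans (le_of_eq ?_) this
  congr 1
  ring

theorem aux_expand_prod (a b k₁ k₂ x δ : ℝ) (hδ : 0 ≤ δ) (hδ1 : δ ≤ 1)
    (ha : |a - k₁ * x| ≤ δ * |x|) (hb : |b - k₂ * x| ≤ δ * |x|) :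
    |a * b - k₁ * k₂ * x ^ 2| ≤ δ * (|k₁| + |k₂| + 1) * x ^ 2 := by
  have e : a * b - k₁ * k₂ * x ^ 2 = (a - k₁ * x) * (b - k₂ * x) + (a - k₁ * x) * (k₂ * x)
      + (k₁ * x) * (b - k₂ * x) := by ring
  have hx : x ^ 2 = |x| * |x| := by rw [← pow_two, sq_abs]
  rw [e]
  have s1 := abs_add_le ((a - k₁ * x) * (b - k₂ * x) + (a - k₁ * x) * (k₂ * x))
    ((k₁ * x) * (b - k₂ * x))
  have s2 := abs_add_le ((a - k₁ * x) * (b - k₂ * x)) ((a - k₁ * x) * (k₂ * x))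
  have t1 : |(a - k₁ * x) * (b - k₂ * x)| ≤ (δ * |x|) * (1 * |x|) := by
    rw [abs_mul]
    refine mul_le_mul ha (hb.trans ?_) (abs_nonneg _) (by positivity)
    gcongr
  have t2 : |(a - k₁ * x) * (k₂ * x)| ≤ (δ * |x|) * (|k₂| * |x|) := by
    rw [abs_mul, abs_mul]
    gcongr
  have t3 : |(k₁ * x) * (b - k₂ * x)| ≤ (|k₁| * |x|) * (δ * |x|) := by
    rw [abs_mul, abs_mul]
    gcongr
  rw [hx]
  nlinarith

/-- Third difference of the product of two families of solutions. -/
theorem aux_third (V₁ V₂ : ℝ → ℝ) (ℓ : ℕ)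
    (hV₁ : ∀ a : ℝ, 0 < a → IntegrableOn (fun r => r * |V₁ r|) (Ioo 0 a))
    (hV₂ : ∀ a : ℝ, 0 < a → IntegrableOn (fun r => r * |V₂ r|) (Ioo 0 a))
    (ψ₁ dψ₁ ψ₂ dψ₂ : ℝ → ℝ → ℝ)
    (hS₁ : ∀ E, AuxSol V₁ ℓ E 1 (fun _ => 0) (ψ₁ E) (dψ₁ E))
    (hS₂ : ∀ E, AuxSol V₂ ℓ E 1 (fun _ => 0) (ψ₂ E) (dψ₂ E))
    (b M : ℝ) (hb : 0 < b) (hM : 0 ≤ M) :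
    ∃ C, 0 ≤ C ∧ ∀ E h, |E| ≤ M → 0 < h → h ≤ 1 → ∀ r ∈ Ioc 0 b,
      |ψ₁ (E + 3 * h) r * ψ₂ (E + 3 * h) r - 3 * (ψ₁ (E + 2 * h) r * ψ₂ (E + 2 * h) r)
        + 3 * (ψ₁ (E + h) r * ψ₂ (E + h) r) - ψ₁ E r * ψ₂ E r| ≤ C * h ^ 3 := by
  have A : ∀ (V : ℝ → ℝ) (hV : ∀ a : ℝ, 0 < a → IntegrableOn (fun r => r * |V r|) (Ioo 0 a))
      (ψ dψ : ℝ → ℝ → ℝ) (hS : ∀ E, AuxSol V ℓ E 1 (fun _ => 0) (ψ E) (dψ E)) (k : ℕ),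
      ∃ C, 0 ≤ C ∧ ∀ E h, |E| ≤ M + 3 → 0 < h → h ≤ 1 → ∀ r ∈ Ioc 0 b,
        |auxD ψ k h E r| ≤ C * h ^ k := by
    intro V hV ψ dψ hS k
    obtain ⟨C, hC, h⟩ := auxD_bound V ℓ hV ψ dψ hS b hb k (M + 3) (by linarith)
    refine ⟨C * b ^ (ℓ + 1), by positivity, fun E h' hE h0 h1 r hr => ?_⟩
    have := (h E h' hE (by rwa [abs_of_pos h0]) r hr).1
    rw [abs_of_pos h0] at this
    refine this.trans ?_
    have hrb : r ^ (ℓ + 1) ≤ b ^ (ℓ + 1) := pow_le_pow_left₀ hr.1.le hr.2 _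
    calc C * h' ^ k * r ^ (ℓ + 1) ≤ C * h' ^ k * b ^ (ℓ + 1) := by gcongr
      _ = _ := by ring
  choose C₁ hC₁ B₁ using A V₁ hV₁ ψ₁ dψ₁ hS₁
  choose C₂ hC₂ B₂ using A V₂ hV₂ ψ₂ dψ₂ hS₂
  refine ⟨C₁ 0 * C₂ 3 + 3 * (C₁ 1 * C₂ 2) + 3 * (C₁ 2 * C₂ 1) + C₁ 3 * C₂ 0, ?_, ?_⟩
  · have := hC₁ 0; have := hC₁ 1; have := hC₁ 2; have := hC₁ 3
    have := hC₂ 0; have := hC₂ 1; have := hC₂ 2; have := hC₂ 3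
    positivity
  intro E h hE h0 h1 r hr
  have hEs : ∀ t : ℝ, 0 ≤ t → t ≤ 3 → |E + t| ≤ M + 3 := by
    intro t ht ht3
    rw [abs_le] at hE ⊢
    constructor <;> linarith
  have e : ψ₁ (E + 3 * h) r * ψ₂ (E + 3 * h) r - 3 * (ψ₁ (E + 2 * h) r * ψ₂ (E + 2 * h) r)
        + 3 * (ψ₁ (E + h) r * ψ₂ (E + h) r) - ψ₁ E r * ψ₂ E r
      = auxD ψ₁ 0 h E r * auxD ψ₂ 3 h E r + 3 * (auxD ψ₁ 1 h E r * auxD ψ₂ 2 h (E + h) r)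
        + 3 * (auxD ψ₁ 2 h E r * auxD ψ₂ 1 h (E + 2 * h) r)
        + auxD ψ₁ 3 h E r * auxD ψ₂ 0 h (E + 3 * h) r := by
    simp only [auxD]
    rw [show E + h + h = E + 2 * h by ring, show E + 2 * h + h = E + 3 * h by ring]
    ring
  rw [e]
  have m : ∀ (a b : ℝ) (i j : ℕ), i + j = 3 → |a| ≤ C₁ i * h ^ i → |b| ≤ C₂ j * h ^ j →
      |a * b| ≤ C₁ i * C₂ j * h ^ 3 := by
    intro a b i j hij ha hb
    rw [abs_mul, ← hij, pow_add]
    calc |a| * |b| ≤ (C₁ i * h ^ i) * (C₂ j * h ^ j) :=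
          mul_le_mul ha hb (abs_nonneg _) (by have := hC₁ i; positivity)
      _ = _ := by ring
  have hE0 := hEs 0 le_rfl (by norm_num)
  rw [add_zero] at hE0
  have t0 := m _ _ 0 3 rfl (B₁ 0 E h hE0 h0 h1 r hr) (B₂ 3 E h hE0 h0 h1 r hr)
  have t1 := m _ _ 1 2 rfl (B₁ 1 E h hE0 h0 h1 r hr)
    (B₂ 2 (E + h) h (hEs h h0.le (by linarith)) h0 h1 r hr)
  have t2 := m _ _ 2 1 rfl (B₁ 2 E h hE0 h0 h1 r hr)
    (B₂ 1 (E + 2 * h) h (hEs (2 * h) (by linarith) (by linarith)) h0 h1 r hr)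
  have t3 := m _ _ 3 0 rfl (B₁ 3 E h hE0 h0 h1 r hr)
    (B₂ 0 (E + 3 * h) h (hEs (3 * h) (by linarith) (by linarith)) h0 h1 r hr)
  rw [abs_le] at t0 t1 t2 t3 ⊢
  constructor <;> linarith [t0.1, t0.2, t1.1, t1.2, t2.1, t2.2, t3.1, t3.2]

theorem aux_leb (f : ℝ → ℝ) (hf : Integrable f) : ∀ᵐ R ∂(volume : Measure ℝ),
    Tendsto (fun d => d⁻¹ * ∫ s in (R - d)..R, |f s - f R|) (𝓝[>] 0) (𝓝 0) := by
  filter_upwards [IsUnifLocDoublingMeasure.ae_tendsto_average_norm_sub volume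
    hf.locallyIntegrable 1] with R hR
  have hpos : ∀ᶠ h in 𝓝[>] (0:ℝ), 0 < h := self_mem_nhdsWithin
  have := hR (l := 𝓝[>] (0:ℝ)) (fun d => R - d / 2) (fun d => d / 2) (by
    refine tendsto_nhdsWithin_iff.2 ⟨?_, ?_⟩
    · have : Tendsto (fun d : ℝ => d / 2) (𝓝 0) (𝓝 (0 / 2)) :=
        (by fun_prop : Continuous fun d : ℝ => d / 2).tendsto 0
      rw [zero_div] at this
      exact this.mono_left nhdsWithin_le_nhds
    · filter_upwards [hpos] with d hd
      exact half_pos hd) (by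
    filter_upwards [hpos] with d hd
    rw [Metric.mem_closedBall, Real.dist_eq, one_mul, abs_of_pos] <;> linarith)
  refine this.congr' ?_
  filter_upwards [hpos] with d hd
  rw [Real.closedBall_eq_Icc, show R - d / 2 - d / 2 = R - d by ring, sub_add_cancel,
    setAverage_eq, intervalIntegral.integral_of_le (by linarith), integral_Icc_eq_integral_Ioc]
  rw [Real.volume_real_Icc_of_le (by linarith), sub_sub_cancel, smul_eq_mul]
  rfl


/-! ### The pointwise estimate at a Lebesgue point -/

theorem aux_point (V₁ V₂ : ℝ → ℝ) (ℓ : ℕ)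
    (hV₁ : ∀ a : ℝ, 0 < a → IntegrableOn (fun r => r * |V₁ r|) (Ioo 0 a))
    (hV₂ : ∀ a : ℝ, 0 < a → IntegrableOn (fun r => r * |V₂ r|) (Ioo 0 a))
    (ψ₁ dψ₁ ψ₂ dψ₂ : ℝ → ℝ → ℝ)
    (hS₁ : ∀ E, AuxSol V₁ ℓ E 1 (fun _ => 0) (ψ₁ E) (dψ₁ E))
    (hS₂ : ∀ E, AuxSol V₂ ℓ E 1 (fun _ => 0) (ψ₂ E) (dψ₂ E))
    (f : ℝ → ℝ) (hf : Integrable f) (rb : ℝ → ℝ) (E0 ρ : ℝ) (hρ : ρ < 0)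
    (hd : HasDerivAt rb ρ E0)
    (leb : Tendsto (fun d => d⁻¹ * ∫ s in (rb E0 - d)..(rb E0), |f s - f (rb E0)|)
      (𝓝[>] 0) (𝓝 0))
    (hev : ∀ᶠ E in 𝓝 E0, 0 < rb E ∧ ψ₁ E (rb E) = 0 ∧ ψ₂ E (rb E) = 0)
    (horth : ∀ᶠ E in 𝓝 E0, ∫ s in (0:ℝ)..(rb E), f s * (ψ₁ E s * ψ₂ E s) = 0)
    (hii : ∀ E R, 0 < R → IntervalIntegrable (fun s => f s * (ψ₁ E s * ψ₂ E s)) volume 0 R)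
    (C : ℝ) (hC : ∀ h, 0 < h → h ≤ 1 → ∀ r ∈ Ioc 0 (rb E0),
      |ψ₁ (E0 + 3 * h) r * ψ₂ (E0 + 3 * h) r - 3 * (ψ₁ (E0 + 2 * h) r * ψ₂ (E0 + 2 * h) r)
        + 3 * (ψ₁ (E0 + h) r * ψ₂ (E0 + h) r) - ψ₁ E0 r * ψ₂ E0 r| ≤ C * h ^ 3)
    (hC0 : 0 ≤ C) :
    2 * |f (rb E0) * (dψ₁ E0 (rb E0) * dψ₂ E0 (rb E0)) * ρ ^ 3|
      ≤ C * ∫ s in (0:ℝ)..(rb E0), |f s| := by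
  set R := rb E0 with hR
  set k₁ := dψ₁ E0 R with hk₁
  set k₂ := dψ₂ E0 R with hk₂
  have hR0 : 0 < R := hev.self_of_nhds.1
  have hpos : ∀ᶠ h in 𝓝[>] (0:ℝ), 0 < h := self_mem_nhdsWithin
  have hid : Tendsto (fun h : ℝ => h) (𝓝[>] 0) (𝓝 0) := tendsto_id.mono_left nhdsWithin_le_nhds
  have hE : ∀ t : ℝ, Tendsto (fun h : ℝ => E0 + t * h) (𝓝[>] 0) (𝓝 E0) := by
    intro t
    have : Tendsto (fun h : ℝ => E0 + t * h) (𝓝 0) (𝓝 (E0 + t * 0)) :=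
      (by fun_prop : Continuous fun h : ℝ => E0 + t * h).tendsto 0
    rw [mul_zero, add_zero] at this
    exact this.mono_left nhdsWithin_le_nhds
  have hrb : ∀ t : ℝ, Tendsto (fun h : ℝ => rb (E0 + t * h)) (𝓝[>] 0) (𝓝 R) :=
    fun t => hd.continuousAt.tendsto.comp (hE t)
  have D : ∀ t : ℝ, Tendsto (fun h : ℝ => (rb (E0 + t * h) - R) / h) (𝓝[>] 0) (𝓝 (ρ * t)) := by
    intro t
    have h1 : HasDerivAt (fun h : ℝ => E0 + t * h) t 0 := by
      simpa using ((hasDerivAt_id (0:ℝ)).const_mul t).const_add E0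
    have h2 : HasDerivAt (fun h : ℝ => rb (E0 + t * h)) (ρ * t) 0 := by
      refine HasDerivAt.comp (0:ℝ) (h₂ := rb) (h := fun h : ℝ => E0 + t * h) ?_ h1
      simpa using hd
    refine h2.tendsto_slope_zero_right.congr fun h => ?_
    simp only [zero_add, mul_zero, add_zero, smul_eq_mul]
    rw [← hR, div_eq_inv_mul]
  have L : ∀ t t' : ℝ, Tendsto (fun h : ℝ => (rb (E0 + t * h) - rb (E0 + t' * h)) / h) (𝓝[>] 0)
      (𝓝 (ρ * t - ρ * t')) := by
    intro t t'
    refine ((D t).sub (D t')).congr fun h => ?_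
    rw [← sub_div]
    congr 1
    ring
  have mono : ∀ t t' : ℝ, t < t' → ∀ᶠ h in 𝓝[>] (0:ℝ), rb (E0 + t' * h) < rb (E0 + t * h) := by
    intro t t' htt
    have : 0 < ρ * t - ρ * t' := by nlinarith
    filter_upwards [(L t t').eventually_const_lt this, hpos] with h h1 h2
    have := mul_pos h1 h2
    rw [div_mul_cancel₀ _ h2.ne'] at this
    linarith
  have mono' : ∀ t : ℝ, 0 ≤ t → ∀ᶠ h in 𝓝[>] (0:ℝ), rb (E0 + t * h) ≤ R := by
    intro t ht
    rcases ht.eq_or_lt with rfl | ht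
    · refine Eventually.of_forall fun h => ?_
      simp [hR]
    · filter_upwards [mono 0 t ht] with h h1
      rw [zero_mul, add_zero] at h1
      exact h1.le
  have S : ∀ t : ℝ, 0 ≤ t → t < 3 → Tendsto (fun h : ℝ =>
      (∫ s in (rb (E0 + 3 * h))..(rb (E0 + t * h)), f s *
        (ψ₁ (E0 + t * h) s * ψ₂ (E0 + t * h) s)) / h ^ 3) (𝓝[>] 0)
      (𝓝 (f R * (k₁ * k₂) * (ρ * t - ρ * 3) ^ 3 / 3)) := by
    intro t ht ht3
    have hμ : Tendsto (fun h : ℝ => (R - rb (E0 + 3 * h)) / h) (𝓝[>] 0) (𝓝 (-(ρ * 3))) := by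
      refine (D 3).neg.congr fun h => ?_
      rw [← neg_div, neg_sub]
    refine aux_asym f hf R leb (fun h => rb (E0 + 3 * h)) (fun h => rb (E0 + t * h))
      (fun h s => ψ₁ (E0 + t * h) s * ψ₂ (E0 + t * h) s) (k₁ * k₂) _ (-(ρ * 3)) (by linarith)
      (L t 3) hμ ?_ ?_ ?_
    · filter_upwards [mono t 3 ht3, mono' t ht] with h h1 h2
      exact ⟨h1.le, h2⟩
    · filter_upwards [(hrb 3).eventually_const_lt hR0] with h h1
      have hsub : Icc (rb (E0 + 3 * h)) (rb (E0 + t * h)) ⊆ Ioi 0 := fun s hs => h1.trans_le hs.1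
      exact ((aux_cont (hS₁ _)).1.mul (aux_cont (hS₂ _)).1).mono hsub
    · intro δ hδ
      have hK : 0 < |k₁| + |k₂| + 1 := by positivity
      set δ' := min 1 (δ / (|k₁| + |k₂| + 1)) with hδ'
      have hδ'0 : 0 < δ' := lt_min one_pos (by positivity)
      obtain ⟨η₁, hη₁, e₁⟩ := aux_expand V₁ ℓ hV₁ ψ₁ dψ₁ hS₁ E0 R hR0 δ' hδ'0
      obtain ⟨η₂, hη₂, e₂⟩ := aux_expand V₂ ℓ hV₂ ψ₂ dψ₂ hS₂ E0 R hR0 δ' hδ'0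
      have hη : 0 < min η₁ η₂ := lt_min hη₁ hη₂
      filter_upwards [(hrb 3).eventually (Metric.ball_mem_nhds R hη),
        (hrb t).eventually (Metric.ball_mem_nhds R hη),
        (hE t).eventually (Metric.ball_mem_nhds E0 hη), (hE t).eventually hev,
        mono t 3 ht3] with h h1 h2 h3 h4 h5 s hs
      rw [Real.dist_eq] at h1 h2 h3
      have hs' : |s - R| < min η₁ η₂ := by
        rw [abs_lt] at h1 h2 ⊢
        constructor <;> linarith [hs.1, hs.2, h1.1, h2.2]
      have a₁ := e₁ _ (h3.trans_le (min_le_left _ _)) s _ (hs'.trans_le (min_le_left _ _))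
        (h2.trans_le (min_le_left _ _)) h4.2.1
      have a₂ := e₂ _ (h3.trans_le (min_le_right _ _)) s _ (hs'.trans_le (min_le_right _ _))
        (h2.trans_le (min_le_right _ _)) h4.2.2
      have := aux_expand_prod _ _ _ _ _ δ' hδ'0.le (min_le_left _ _) a₁ a₂
      refine this.trans ?_
      refine mul_le_mul_of_nonneg_right ?_ (sq_nonneg _)
      calc δ' * (|k₁| + |k₂| + 1) ≤ δ / (|k₁| + |k₂| + 1) * (|k₁| + |k₂| + 1) :=
            mul_le_mul_of_nonneg_right (min_le_right _ _) hK.le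
        _ = δ := div_mul_cancel₀ _ hK.ne'
  have T := (((S 0 le_rfl (by norm_num)).const_mul (-1)).add
    ((S 1 zero_le_one (by norm_num)).const_mul 3)).add
    ((S 2 zero_le_two (by norm_num)).const_mul (-3))
  rw [show -1 * (f R * (k₁ * k₂) * (ρ * 0 - ρ * 3) ^ 3 / 3)
      + 3 * (f R * (k₁ * k₂) * (ρ * 1 - ρ * 3) ^ 3 / 3)
      + -3 * (f R * (k₁ * k₂) * (ρ * 2 - ρ * 3) ^ 3 / 3) = 2 * (f R * (k₁ * k₂) * ρ ^ 3) by ring] at T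
  have T' := T.abs
  rw [abs_mul, abs_of_pos (zero_lt_two' ℝ)] at T'
  refine le_of_tendsto T' ?_
  have le1 : ∀ᶠ h in 𝓝[>] (0:ℝ), h ≤ 1 := hid.eventually (Iic_mem_nhds one_pos)
  filter_upwards [hpos, le1, (hE 0).eventually hev, (hE 1).eventually hev, (hE 2).eventually hev,
    (hE 3).eventually hev, (hE 0).eventually horth, (hE 1).eventually horth,
    (hE 2).eventually horth, (hE 3).eventually horth, mono' 3 (by norm_num)]
    with h h0 h1 p0 p1 p2 p3 o0 o1 o2 o3 hm
  set R3 := rb (E0 + 3 * h) with hR3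
  have split : ∀ t : ℝ, 0 < rb (E0 + t * h) →
      ∫ s in (0:ℝ)..(rb (E0 + t * h)), f s * (ψ₁ (E0 + t * h) s * ψ₂ (E0 + t * h) s) = 0 →
      ∫ s in R3..(rb (E0 + t * h)), f s * (ψ₁ (E0 + t * h) s * ψ₂ (E0 + t * h) s)
        = - ∫ s in (0:ℝ)..R3, f s * (ψ₁ (E0 + t * h) s * ψ₂ (E0 + t * h) s) := by
    intro t pt ot
    have := intervalIntegral.integral_interval_sub_left (hii (E0 + t * h) _ pt)
      (hii (E0 + t * h) R3 p3.1)
    rw [← this, ot, zero_sub]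
  rw [split 0 p0.1 o0, split 1 p1.1 o1, split 2 p2.1 o2]
  have J : ∫ s in (0:ℝ)..R3, f s * (ψ₁ (E0 + 3 * h) s * ψ₂ (E0 + 3 * h) s
        - 3 * (ψ₁ (E0 + 2 * h) s * ψ₂ (E0 + 2 * h) s)
        + 3 * (ψ₁ (E0 + 1 * h) s * ψ₂ (E0 + 1 * h) s) - ψ₁ (E0 + 0 * h) s * ψ₂ (E0 + 0 * h) s)
      = (∫ s in (0:ℝ)..R3, f s * (ψ₁ (E0 + 3 * h) s * ψ₂ (E0 + 3 * h) s))
        - 3 * (∫ s in (0:ℝ)..R3, f s * (ψ₁ (E0 + 2 * h) s * ψ₂ (E0 + 2 * h) s))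
        + 3 * (∫ s in (0:ℝ)..R3, f s * (ψ₁ (E0 + 1 * h) s * ψ₂ (E0 + 1 * h) s))
        - ∫ s in (0:ℝ)..R3, f s * (ψ₁ (E0 + 0 * h) s * ψ₂ (E0 + 0 * h) s) := by
    have i := fun t : ℝ => hii (E0 + t * h) R3 p3.1
    rw [← intervalIntegral.integral_const_mul, ← intervalIntegral.integral_const_mul,
      ← intervalIntegral.integral_sub (i 3) ((i 2).const_mul 3),
      ← intervalIntegral.integral_add ((i 3).sub ((i 2).const_mul 3)) ((i 1).const_mul 3),
      ← intervalIntegral.integral_sub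
        (((i 3).sub ((i 2).const_mul 3)).add ((i 1).const_mul 3)) (i 0)]
    congr 1
    ext s
    ring
  rw [o3] at J
  have K : |∫ s in (0:ℝ)..R3, f s * (ψ₁ (E0 + 3 * h) s * ψ₂ (E0 + 3 * h) s
        - 3 * (ψ₁ (E0 + 2 * h) s * ψ₂ (E0 + 2 * h) s)
        + 3 * (ψ₁ (E0 + 1 * h) s * ψ₂ (E0 + 1 * h) s) - ψ₁ (E0 + 0 * h) s * ψ₂ (E0 + 0 * h) s)|
      ≤ C * h ^ 3 * ∫ s in (0:ℝ)..R, |f s| := by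
    have ii : IntervalIntegrable (fun s => C * h ^ 3 * |f s|) volume 0 R3 :=
      hf.abs.intervalIntegrable.const_mul _
    rw [← Real.norm_eq_abs]
    refine (intervalIntegral.norm_integral_le_of_norm_le p3.1.le
      (Eventually.of_forall fun s hs => ?_) ii).trans ?_
    · rw [norm_mul, mul_comm, Real.norm_eq_abs, Real.norm_eq_abs]
      refine mul_le_mul_of_nonneg_right ?_ (abs_nonneg _)
      have := hC h h0 h1 s ⟨hs.1, hs.2.trans hm⟩
      rwa [one_mul, zero_mul, add_zero]
    · rw [intervalIntegral.integral_const_mul]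
      refine mul_le_mul_of_nonneg_left ?_ (by positivity)
      exact intervalIntegral.integral_mono_interval le_rfl p3.1.le hm
        (Eventually.of_forall fun s => abs_nonneg _) hf.abs.intervalIntegrable
  have hh : 0 < h ^ 3 := by positivity
  have F : ∀ a b c : ℝ, -1 * (-a / h ^ 3) + 3 * (-b / h ^ 3) + -3 * (-c / h ^ 3)
      = -(0 - 3 * c + 3 * b - a) / h ^ 3 := by
    intro a b c
    ring
  rw [F, ← J, abs_div, abs_neg, abs_of_pos hh, div_le_iff₀ hh]
  linarith


/-! ### Conclusion -/

theorem aux_alg (k₁ k₂ N₁ N₂ ρ c₁ c₂ D₁ D₂ : ℝ) (hc₁ : 0 < c₁) (hc₂ : 0 < c₂)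
    (hk₁ : k₁ ≠ 0) (hk₂ : k₂ ≠ 0) (hD₁ : |k₁| ≤ D₁) (hD₂ : |k₂| ≤ D₂)
    (hN₁ : c₁ ≤ N₁) (hN₂ : c₂ ≤ N₂) (e₁ : ρ = -N₁ / k₁ ^ 2) (e₂ : ρ = -N₂ / k₂ ^ 2) :
    Real.sqrt ((c₁ * c₂) ^ 3 / ((D₁ * D₂) ^ 2) ^ 2) ≤ |k₁ * k₂ * ρ ^ 3| := by
  rw [← Real.sqrt_sq_eq_abs]
  refine Real.sqrt_le_sqrt ?_
  have f₁ : ρ * k₁ ^ 2 = -N₁ := by rw [e₁]; field_simp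
  have f₂ : ρ * k₂ ^ 2 = -N₂ := by rw [e₂]; field_simp
  have hP : 0 < (k₁ * k₂) ^ 2 := by positivity
  have hPD : (k₁ * k₂) ^ 2 ≤ (D₁ * D₂) ^ 2 := by
    rw [← sq_abs, abs_mul]
    have : 0 ≤ D₁ := (abs_nonneg _).trans hD₁
    gcongr
  have e : (k₁ * k₂ * ρ ^ 3) ^ 2 = (N₁ * N₂) ^ 3 / ((k₁ * k₂) ^ 2) ^ 2 := by
    rw [eq_div_iff (by positivity)]
    have : N₁ * N₂ = (ρ * k₁ ^ 2) * (ρ * k₂ ^ 2) := by rw [f₁, f₂]; ring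
    rw [this]
    ring
  rw [e]
  have : 0 < N₁ := hc₁.trans_le hN₁
  have : 0 < N₂ := hc₂.trans_le hN₂
  have : 0 ≤ (N₁ * N₂) ^ 3 := by positivity
  gcongr

theorem aux_nhds (I : Set ℝ) (hI : I.OrdConnected) (rb : ℝ → ℝ) (hanti : StrictAntiOn rb I)
    (hsurj : rb '' I = Ioi 0) (E : ℝ) (hE : E ∈ I) : I ∈ 𝓝 E := by
  have h0 : 0 < rb E := by
    have : rb E ∈ rb '' I := mem_image_of_mem _ hE
    rwa [hsurj] at this
  obtain ⟨E₁, hE₁, h₁⟩ : rb E + 1 ∈ rb '' I := by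
    rw [hsurj]; exact show (0:ℝ) < _ by linarith
  obtain ⟨E₂, hE₂, h₂⟩ : rb E / 2 ∈ rb '' I := by
    rw [hsurj]; exact show (0:ℝ) < _ by linarith
  have l₁ : E₁ < E := by
    by_contra! h
    have := hanti.antitoneOn hE hE₁ h
    linarith
  have l₂ : E < E₂ := by
    by_contra! h
    have := hanti.antitoneOn hE₂ hE h
    linarith
  exact mem_of_superset (Icc_mem_nhds l₁ l₂) (hI.out hE₁ hE₂)

theorem aux_deriv (V : ℝ → ℝ) (ℓ : ℕ)
    (hV : ∀ a : ℝ, 0 < a → IntegrableOn (fun r => r * |V r|) (Ioo 0 a))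
    (ψ dψ : ℝ → ℝ → ℝ)
    (hS : ∀ E, AuxSol V ℓ E 1 (fun _ => 0) (ψ E) (dψ E))
    (I : Set ℝ) (hI : I.OrdConnected) (rb : ℝ → ℝ) (hcont : ContinuousOn rb I)
    (hanti : StrictAntiOn rb I)
    (hsurj : rb '' I = Ioi 0) (hz : ∀ E ∈ I, 0 < rb E ∧ ψ E (rb E) = 0) (E : ℝ) (hE : E ∈ I) :
    HasDerivAt rb (-(∫ s in (0:ℝ)..rb E, ψ E s * ψ E s) / (dψ E (rb E)) ^ 2) E := by
  have hN := aux_nhds I hI rb hanti hsurj E hE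
  refine aux_rbar_deriv V ℓ hV ψ dψ hS rb E (hcont.continuousAt hN) ?_ ?_
  · filter_upwards [hN] with E' hE' using hz E' hE'
  · filter_upwards [nhdsWithin_le_nhds hN, self_mem_nhdsWithin] with E' hE' hne h
    exact hne (hanti.injOn hE' hE h)

theorem aux_const_eq (V₁ V₂ : ℝ → ℝ) (ℓ : ℕ)
    (hV₁ : ∀ a : ℝ, 0 < a → IntegrableOn (fun r => r * |V₁ r|) (Ioo 0 a))
    (hV₂ : ∀ a : ℝ, 0 < a → IntegrableOn (fun r => r * |V₂ r|) (Ioo 0 a))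
    (ψ₁ dψ₁ ψ₂ dψ₂ : ℝ → ℝ → ℝ)
    (hS₁ : ∀ E, AuxSol V₁ ℓ E 1 (fun _ => 0) (ψ₁ E) (dψ₁ E))
    (hS₂ : ∀ E, AuxSol V₂ ℓ E 1 (fun _ => 0) (ψ₂ E) (dψ₂ E))
    (I : Set ℝ) (hI : I.OrdConnected) (rb : ℝ → ℝ) (hcont : ContinuousOn rb I)
    (hanti : StrictAntiOn rb I) (hsurj : rb '' I = Ioi 0)
    (hz₁ : ∀ E ∈ I, 0 < rb E ∧ ψ₁ E (rb E) = 0) (hz₂ : ∀ E ∈ I, 0 < rb E ∧ ψ₂ E (rb E) = 0)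
    (a c₁ c₂ : ℝ) (ha : 0 < a) (h₁ : ∀ r ∈ Ioo 0 a, V₁ r = c₁) (h₂ : ∀ r ∈ Ioo 0 a, V₂ r = c₂) :
    c₁ = c₂ := by
  obtain ⟨E, hE, hR⟩ : a / 2 ∈ rb '' I := by
    rw [hsurj]; exact show (0:ℝ) < _ by linarith
  have hR0 := (hz₁ E hE).1
  have v₁ := aux_virial V₁ ℓ hV₁ ψ₁ dψ₁ hS₁ a c₁ E (rb E) h₁ hR0 (by linarith) (hz₁ E hE).2
  have v₂ := aux_virial V₂ ℓ hV₂ ψ₂ dψ₂ hS₂ a c₂ E (rb E) h₂ hR0 (by linarith) (hz₂ E hE).2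
  have d := (aux_deriv V₁ ℓ hV₁ ψ₁ dψ₁ hS₁ I hI rb hcont hanti hsurj hz₁ E hE).unique
    (aux_deriv V₂ ℓ hV₂ ψ₂ dψ₂ hS₂ I hI rb hcont hanti hsurj hz₂ E hE)
  have k₁ := aux_simple V₁ ℓ hV₁ ψ₁ dψ₁ hS₁ E (rb E) hR0 (hz₁ E hE).2
  have k₂ := aux_simple V₂ ℓ hV₂ ψ₂ dψ₂ hS₂ E (rb E) hR0 (hz₂ E hE).2
  obtain ⟨m, hm, hm'⟩ := aux_N_lower V₁ ℓ hV₁ ψ₁ dψ₁ hS₁ |E| (rb E) (abs_nonneg _) hR0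
  have n₁ := hm.trans_le (hm' E le_rfl _ le_rfl)
  set N₁ := ∫ s in (0:ℝ)..rb E, ψ₁ E s * ψ₁ E s
  set N₂ := ∫ s in (0:ℝ)..rb E, ψ₂ E s * ψ₂ E s
  rw [div_eq_div_iff (by positivity) (by positivity)] at d
  set x := (dψ₁ E (rb E)) ^ 2 with hx
  set y := (dψ₂ E (rb E)) ^ 2 with hy
  have hx0 : 0 < x := by positivity
  have hy0 : 0 < y := by positivity
  -- `N₁ y = N₂ x`, `R x = 2 (E - c₁) N₁`, `R y = 2 (E - c₂) N₂`
  have h : (c₁ - c₂) * (N₁ * y) = 0 := by 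
    linear_combination (y / 2) * v₁ - (x / 2) * v₂ - (E - c₂) * d
  have h3 : N₁ * y ≠ 0 := by positivity
  exact sub_eq_zero.1 ((mul_eq_zero.1 h).resolve_right h3)

theorem aux_zero (f : ℝ → ℝ) (hf : Integrable f) (b K : ℝ) (hb : 0 < b) (hK : 0 ≤ K)
    (h : ∀ᵐ R ∂(volume : Measure ℝ), R ∈ Ioc 0 b → |f R| ≤ K * ∫ s in (0:ℝ)..R, |f s|) :
    ∀ᵐ R ∂(volume : Measure ℝ), R ∈ Ioc 0 b → f R = 0 := by
  set F : ℝ → ℝ := fun r => ∫ s in (0:ℝ)..r, |f s| with hF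
  have hFc : Continuous F :=
    intervalIntegral.continuous_primitive (fun _ _ => hf.abs.intervalIntegrable) 0
  obtain ⟨C, hC, g⟩ := aux_gronwall (fun _ => K) b hb intervalIntegrable_const (fun _ _ => hK)
  have hz : ∀ r ∈ Ioc 0 b, F r ≤ C * 0 := by
    refine g F 0 (F b) le_rfl hFc.aestronglyMeasurable ?_ ?_ ?_
    · intro r hr
      exact intervalIntegral.integral_nonneg hr.1.le fun s _ => abs_nonneg _
    · intro r hr
      exact intervalIntegral.integral_mono_interval le_rfl hr.1.le hr.2
        (Eventually.of_forall fun s => abs_nonneg _) hf.abs.intervalIntegrable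
    · intro r hr
      rw [zero_add]
      refine intervalIntegral.integral_mono_ae_restrict hr.1.le hf.abs.intervalIntegrable
        ((hFc.const_mul K).intervalIntegrable _ _) ?_
      rw [EventuallyLE, ae_restrict_iff' measurableSet_Icc]
      have h0 : ∀ᵐ s ∂(volume : Measure ℝ), s ≠ 0 := by simp [ae_iff]
      filter_upwards [h, h0] with s hs hs0 hs1
      exact hs ⟨lt_of_le_of_ne hs1.1 (Ne.symm hs0), hs1.2.trans hr.2⟩
  filter_upwards [h] with R hR hR'
  have h1 := hR hR'
  have h2 := hz R hR'
  have h3 : |f R| ≤ 0 := h1.trans (by rw [mul_zero] at h2; exact mul_nonpos_of_nonneg_of_nonpos hK h2)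
  exact abs_nonpos_iff.1 h3


theorem aux_estimate (V₁ V₂ : ℝ → ℝ) (ℓ : ℕ)
    (hV₁ : ∀ a : ℝ, 0 < a → IntegrableOn (fun r => r * |V₁ r|) (Ioo 0 a))
    (hV₂ : ∀ a : ℝ, 0 < a → IntegrableOn (fun r => r * |V₂ r|) (Ioo 0 a))
    (ψ₁ dψ₁ ψ₂ dψ₂ : ℝ → ℝ → ℝ)
    (hS₁ : ∀ E, AuxSol V₁ ℓ E 1 (fun _ => 0) (ψ₁ E) (dψ₁ E))
    (hS₂ : ∀ E, AuxSol V₂ ℓ E 1 (fun _ => 0) (ψ₂ E) (dψ₂ E))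
    (I : Set ℝ) (hI : I.OrdConnected) (rb : ℝ → ℝ) (hcont : ContinuousOn rb I)
    (hanti : StrictAntiOn rb I) (hsurj : rb '' I = Ioi 0)
    (hz₁ : ∀ E ∈ I, 0 < rb E ∧ ψ₁ E (rb E) = 0) (hz₂ : ∀ E ∈ I, 0 < rb E ∧ ψ₂ E (rb E) = 0)
    (f : ℝ → ℝ) (hf : Integrable f) (hfV : ∀ s, 0 < s → f s = V₂ s - V₁ s)
    (a : ℝ) (ha : 0 < a) (hfa : ∀ s, s ≤ a → f s = 0) (b : ℝ) (hb : 0 < b) :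
    ∃ K, 0 ≤ K ∧ ∀ᵐ R ∂(volume : Measure ℝ), R ∈ Ioc 0 b →
      |f R| ≤ K * ∫ s in (0:ℝ)..R, |f s| := by
  obtain ⟨Ea, hEa, hRa⟩ : a ∈ rb '' I := by rw [hsurj]; exact ha
  obtain ⟨Eb, hEb, hRb⟩ : b ∈ rb '' I := by rw [hsurj]; exact hb
  set M := max |Ea| |Eb| with hM
  have hM0 : 0 ≤ M := le_max_of_le_left (abs_nonneg _)
  have hEM : ∀ E ∈ I, a ≤ rb E → rb E ≤ b → |E| ≤ M := by
    intro E hE h1 h2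
    have l₁ : E ≤ Ea := by
      by_contra! h
      have := hanti hEa hE h
      linarith
    have l₂ : Eb ≤ E := by
      by_contra! h
      have := hanti hE hEb h
      linarith
    rw [abs_le]
    constructor
    · linarith [neg_abs_le Eb, le_max_right |Ea| |Eb|]
    · linarith [le_abs_self Ea, le_max_left |Ea| |Eb|]
  obtain ⟨C, hC0, hC⟩ := aux_third V₁ V₂ ℓ hV₁ hV₂ ψ₁ dψ₁ ψ₂ dψ₂ hS₁ hS₂ b M hb hM0
  obtain ⟨c₁, hc₁, n₁⟩ := aux_N_lower V₁ ℓ hV₁ ψ₁ dψ₁ hS₁ M a hM0 ha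
  obtain ⟨c₂, hc₂, n₂⟩ := aux_N_lower V₂ ℓ hV₂ ψ₂ dψ₂ hS₂ M a hM0 ha
  obtain ⟨D₁, hD₁, d₁⟩ := aux_bounds V₁ ℓ hV₁ ψ₁ dψ₁ hS₁ b M hb hM0
  obtain ⟨D₂, hD₂, d₂⟩ := aux_bounds V₂ ℓ hV₂ ψ₂ dψ₂ hS₂ b M hb hM0
  have hii : ∀ E R, 0 < R →
      IntervalIntegrable (fun s => f s * (ψ₁ E s * ψ₂ E s)) volume 0 R := by
    intro E R hR
    obtain ⟨B₁, hB₁, b₁⟩ := aux_bounds V₁ ℓ hV₁ ψ₁ dψ₁ hS₁ R |E| hR (abs_nonneg _)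
    obtain ⟨B₂, hB₂, b₂⟩ := aux_bounds V₂ ℓ hV₂ ψ₂ dψ₂ hS₂ R |E| hR (abs_nonneg _)
    rw [intervalIntegrable_iff_integrableOn_Ioc_of_le hR.le]
    have hco : ContinuousOn (fun s => ψ₁ E s * ψ₂ E s) (Ioc 0 R) :=
      ((aux_cont (hS₁ E)).1.mul (aux_cont (hS₂ E)).1).mono fun s hs => hs.1
    refine Integrable.mono' (hf.abs.integrableOn.const_mul (B₁ * B₂))
      (hf.aestronglyMeasurable.restrict.mul (hco.aestronglyMeasurable measurableSet_Ioc)) ?_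
    rw [ae_restrict_iff' measurableSet_Ioc]
    refine Eventually.of_forall fun s hs => ?_
    rw [Real.norm_eq_abs, abs_mul, abs_mul, mul_comm]
    refine mul_le_mul_of_nonneg_right ?_ (abs_nonneg _)
    exact mul_le_mul (b₁ E le_rfl s hs).1 (b₂ E le_rfl s hs).1 (abs_nonneg _) hB₁.le
  have horth : ∀ E ∈ I, ∫ s in (0:ℝ)..(rb E), f s * (ψ₁ E s * ψ₂ E s) = 0 := by
    intro E hE
    have hR := (hz₁ E hE).1
    have e : ∀ s ∈ Ioc 0 (rb E), f s * (ψ₁ E s * ψ₂ E s)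
        = (V₂ s - V₁ s + (E - E)) * (ψ₁ E s * ψ₂ E s) := by
      intro s hs
      rw [hfV s hs.1, sub_self, add_zero]
    have w := aux_wronskian V₁ V₂ ℓ hV₁ hV₂ ψ₁ dψ₁ ψ₂ dψ₂ hS₁ hS₂ E E (rb E) hR (by
      refine (hii E (rb E) hR).congr ?_
      rw [uIoc_of_le hR.le]
      exact fun s hs => e s hs)
    rw [(hz₁ E hE).2, (hz₂ E hE).2, zero_mul, mul_zero, sub_zero] at w
    refine Eq.trans ?_ w.symm
    refine intervalIntegral.integral_congr_ae (Eventually.of_forall fun s hs => ?_)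
    rw [uIoc_of_le hR.le] at hs
    exact e s hs
  set m := Real.sqrt ((c₁ * c₂) ^ 3 / ((D₁ * D₂) ^ 2) ^ 2) with hm
  have hm0 : 0 < m := Real.sqrt_pos.2 (by positivity)
  refine ⟨C / (2 * m), by positivity, ?_⟩
  filter_upwards [aux_leb f hf] with R leb hR
  have hF : 0 ≤ ∫ s in (0:ℝ)..R, |f s| :=
    intervalIntegral.integral_nonneg hR.1.le fun s _ => abs_nonneg _
  rcases le_or_gt R a with hRa' | hRa'
  · rw [hfa R hRa', abs_zero]
    positivity
  obtain ⟨E, hE, hRE⟩ : R ∈ rb '' I := by rw [hsurj]; exact hR.1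
  subst hRE
  have hEM' := hEM E hE hRa'.le hR.2
  have hN := aux_nhds I hI rb hanti hsurj E hE
  have r₁ := aux_deriv V₁ ℓ hV₁ ψ₁ dψ₁ hS₁ I hI rb hcont hanti hsurj hz₁ E hE
  have r₂ := aux_deriv V₂ ℓ hV₂ ψ₂ dψ₂ hS₂ I hI rb hcont hanti hsurj hz₂ E hE
  have k₁ := aux_simple V₁ ℓ hV₁ ψ₁ dψ₁ hS₁ E (rb E) hR.1 (hz₁ E hE).2
  have k₂ := aux_simple V₂ ℓ hV₂ ψ₂ dψ₂ hS₂ E (rb E) hR.1 (hz₂ E hE).2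
  have N₁ := n₁ E hEM' (rb E) hRa'.le
  have N₂ := n₂ E hEM' (rb E) hRa'.le
  have al := aux_alg _ _ _ _ _ c₁ c₂ D₁ D₂ hc₁ hc₂ k₁ k₂ (d₁ E hEM' (rb E) hR).2.1
    (d₂ E hEM' (rb E) hR).2.1 N₁ N₂ rfl (r₁.unique r₂)
  have hρ : -(∫ s in (0:ℝ)..rb E, ψ₁ E s * ψ₁ E s) / (dψ₁ E (rb E)) ^ 2 < 0 := by
    have : 0 < ∫ s in (0:ℝ)..rb E, ψ₁ E s * ψ₁ E s := hc₁.trans_le N₁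
    exact div_neg_of_neg_of_pos (by linarith) (by positivity)
  have p := aux_point V₁ V₂ ℓ hV₁ hV₂ ψ₁ dψ₁ ψ₂ dψ₂ hS₁ hS₂ f hf rb E _ hρ r₁ leb
    (by filter_upwards [hN] with E' hE' using ⟨(hz₁ E' hE').1, (hz₁ E' hE').2, (hz₂ E' hE').2⟩)
    (by filter_upwards [hN] with E' hE' using horth E' hE') hii C
    (fun h h0 h1 r hr => hC E h hEM' h0 h1 r ⟨hr.1, hr.2.trans hR.2⟩) hC0
  rw [mul_assoc (f (rb E)), abs_mul (f (rb E))] at p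
  rw [div_mul_eq_mul_div, le_div_iff₀ (by positivity)]
  refine le_trans ?_ p
  have := mul_le_mul_of_nonneg_left al (abs_nonneg (f (rb E)))
  linarith

theorem aux_regular (V : ℝ → ℝ) (ℓ : ℕ) (E : ℝ) (ψ : ℝ → ℝ)
    (h : IsRegularSolution V (ℓ : ℝ) E ψ) : AuxSol V ℓ E 1 (fun _ => 0) ψ (deriv ψ) := by
  obtain ⟨h1, h2, h3⟩ := h
  refine ⟨fun r hr => (h1 r hr).1.hasDerivAt, fun r hr => ?_, ?_⟩
  · refine (h1 r hr).2.hasDerivAt.congr_deriv ?_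
    have := h2 r hr
    linear_combination this
  · refine h3.congr' ?_
    filter_upwards [self_mem_nhdsWithin] with r hr
    rw [← Real.rpow_natCast]
    push_cast
    rfl

theorem aux_int_tail (V : ℝ → ℝ) (hm : AEStronglyMeasurable V (volume.restrict (Ioi 0)))
    (b : ℝ) (hb : 0 < b) (h : IntegrableOn (fun r => |V r|) (Ioi b)) : IntegrableOn V (Ioi b) := by
  have hm' : AEStronglyMeasurable V (volume.restrict (Ioi b)) :=
    hm.mono_measure (Measure.restrict_mono (Ioi_subset_Ioi hb.le) le_rfl)
  exact (integrable_norm_iff hm').1 h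

/-- Uniqueness theorem: two potentials satisfying the integrability conditions
`∫₀^a r|V| dr < ∞` and `∫_b^∞ |V| dr < ∞`, each locally constant in the
vicinity of zero, whose regular solutions possess a common line of zeros
(the `n₁`-th line for `V₁` coinciding with the `n₂`-th line for `V₂`),
monotonic and describing the whole positive axis, coincide almost everywhere. -/
theorem potential_unique_from_common_line_of_zeros
    (ℓ : ℕ)
    (V₁ V₂ : ℝ → ℝ)
    (h_int₁ : ∀ a : ℝ, 0 < a → IntegrableOn (fun r => r * |V₁ r|) (Set.Ioo 0 a))
    (h_int₁' : ∀ b : ℝ, 0 < b → IntegrableOn (fun r => |V₁ r|) (Set.Ioi b))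
    (h_int₂ : ∀ a : ℝ, 0 < a → IntegrableOn (fun r => r * |V₂ r|) (Set.Ioo 0 a))
    (h_int₂' : ∀ b : ℝ, 0 < b → IntegrableOn (fun r => |V₂ r|) (Set.Ioi b))
    (hloc₁ : ∃ ε > 0, ∃ c : ℝ, ∀ r ∈ Set.Ioo (0 : ℝ) ε, V₁ r = c)
    (hloc₂ : ∃ ε > 0, ∃ c : ℝ, ∀ r ∈ Set.Ioo (0 : ℝ) ε, V₂ r = c)
    (ψ₁ ψ₂ : ℝ → ℝ → ℝ)
    (hψ₁ : ∀ E : ℝ, IsRegularSolution V₁ (ℓ : ℝ) E (ψ₁ E))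
    (hψ₂ : ∀ E : ℝ, IsRegularSolution V₂ (ℓ : ℝ) E (ψ₂ E))
    (n₁ n₂ : ℕ) (hn₁ : 1 ≤ n₁) (hn₂ : 1 ≤ n₂)
    (I : Set ℝ) (hIint : I.OrdConnected)
    (rbar : ℝ → ℝ)
    (hcont : ContinuousOn rbar I)
    (hanti : StrictAntiOn rbar I)
    (hsurj : rbar '' I = Set.Ioi 0)
    (hz₁ : ∀ E ∈ I, IsNthZero (ψ₁ E) n₁ (rbar E))
    (hz₂ : ∀ E ∈ I, IsNthZero (ψ₂ E) n₂ (rbar E)) :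
    ∀ᵐ r ∂(volume : Measure ℝ), r ∈ Set.Ioi (0 : ℝ) → V₁ r = V₂ r := by
  obtain ⟨ε₁, hε₁, c₁, hc₁⟩ := hloc₁
  obtain ⟨ε₂, hε₂, c₂, hc₂⟩ := hloc₂
  have hS₁ : ∀ E, AuxSol V₁ ℓ E 1 (fun _ => 0) (ψ₁ E) (deriv (ψ₁ E)) :=
    fun E => aux_regular V₁ ℓ E (ψ₁ E) (hψ₁ E)
  have hS₂ : ∀ E, AuxSol V₂ ℓ E 1 (fun _ => 0) (ψ₂ E) (deriv (ψ₂ E)) :=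
    fun E => aux_regular V₂ ℓ E (ψ₂ E) (hψ₂ E)
  have hz₁' : ∀ E ∈ I, 0 < rbar E ∧ ψ₁ E (rbar E) = 0 := fun E hE => ⟨(hz₁ E hE).1, (hz₁ E hE).2.1⟩
  have hz₂' : ∀ E ∈ I, 0 < rbar E ∧ ψ₂ E (rbar E) = 0 := fun E hE => ⟨(hz₂ E hE).1, (hz₂ E hE).2.1⟩
  set a := min ε₁ ε₂ with ha
  have ha0 : 0 < a := lt_min hε₁ hε₂
  have h₁ : ∀ r ∈ Ioo 0 a, V₁ r = c₁ := fun r hr => hc₁ r ⟨hr.1, hr.2.trans_le (min_le_left _ _)⟩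
  have h₂ : ∀ r ∈ Ioo 0 a, V₂ r = c₂ := fun r hr => hc₂ r ⟨hr.1, hr.2.trans_le (min_le_right _ _)⟩
  have hcc : c₁ = c₂ := aux_const_eq V₁ V₂ ℓ h_int₁ h_int₂ ψ₁ (fun E => deriv (ψ₁ E)) ψ₂
    (fun E => deriv (ψ₂ E)) hS₁ hS₂ I hIint rbar hcont hanti hsurj hz₁' hz₂' a c₁ c₂ ha0 h₁ h₂
  have ha2 : 0 < a / 2 := half_pos ha0
  have iV₁ := aux_int_tail V₁ (aux_meas V₁ ℓ h_int₁ ψ₁ (fun E => deriv (ψ₁ E)) hS₁) (a / 2) ha2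
    (h_int₁' _ ha2)
  have iV₂ := aux_int_tail V₂ (aux_meas V₂ ℓ h_int₂ ψ₂ (fun E => deriv (ψ₂ E)) hS₂) (a / 2) ha2
    (h_int₂' _ ha2)
  set f : ℝ → ℝ := (Ioi (a / 2)).indicator (fun s => V₂ s - V₁ s) with hf
  have hfi : Integrable f := (iV₂.sub iV₁).integrable_indicator measurableSet_Ioi
  have hfa : ∀ s, s ≤ a / 2 → f s = 0 := fun s hs =>
    indicator_of_notMem (fun h => absurd h (not_lt.2 hs)) _
  have hfV : ∀ s, 0 < s → f s = V₂ s - V₁ s := by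
    intro s hs
    rcases le_or_gt s (a / 2) with h | h
    · have hm : s ∈ Ioo 0 a := ⟨hs, by linarith⟩
      rw [hfa s h, h₁ s hm, h₂ s hm, hcc, sub_self]
    · exact indicator_of_mem (show s ∈ Ioi (a / 2) from h) _
  have hzero : ∀ n : ℕ, ∀ᵐ R ∂(volume : Measure ℝ), R ∈ Ioc (0:ℝ) ((n : ℝ) + 1) → f R = 0 := by
    intro n
    have hb : (0:ℝ) < (n : ℝ) + 1 := by positivity
    obtain ⟨K, hK, h⟩ := aux_estimate V₁ V₂ ℓ h_int₁ h_int₂ ψ₁ (fun E => deriv (ψ₁ E)) ψ₂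
      (fun E => deriv (ψ₂ E)) hS₁ hS₂ I hIint rbar hcont hanti hsurj hz₁' hz₂' f hfi hfV
      (a / 2) ha2 hfa ((n : ℝ) + 1) hb
    exact aux_zero f hfi _ K hb hK h
  filter_upwards [ae_all_iff.2 hzero] with R hR hR0
  obtain ⟨n, hn⟩ := exists_nat_gt R
  have := hR n ⟨hR0, by linarith⟩
  rw [hfV R hR0] at this
  linarith
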